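/- arXiv:0912.4713 — 3 statements merged into one kernel-verified Lean document; each statement's English description precedes it below -/
import Mathlib

section
/- Let S* be a family of switching signals with property P and let T* be the set of all complete trajectories (x̄,σ̄) of the switched system ẋ = f(x,σ) with σ̄ ∈ S*. If (x,σ) is a precompact forward complete trajectory of the switched system with σ ∈ S*, then the set Ω♯(x,σ) is weakly invariant w.r.t. T*. -/
open Filter Topology MeasureTheory Set

noncomputable section

abbrev Eucl (n : ℕ) : Type := EuclideanSpace ℝ (Fin n)

/-- The set of discontinuity (switching) times of a signal. -/
def JumpTimes {Γ : Type*} [TopologicalSpace Γ] (σ : ℝ → Γ) : Set ℝ :=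
  {t | ¬ ContinuousAt σ t}

/-- A switching signal: piecewise constant (finitely many discontinuities in every
compact interval, locally constant to the right and on a left punctured neighborhood
of every point) and continuous from the right. -/
structure IsSwitchingSignal {Γ : Type*} [TopologicalSpace Γ] (σ : ℝ → Γ) : Prop where
  locFinite : ∀ a b : ℝ, (JumpTimes σ ∩ Set.Icc a b).Finite
  rightConst : ∀ t : ℝ, ∃ ε > (0:ℝ), ∀ s ∈ Set.Ico t (t + ε), σ s = σ t
  leftConst : ∀ t : ℝ, ∃ ε > (0:ℝ), ∀ s ∈ Set.Ioo (t - ε) t, ∀ s' ∈ Set.Ioo (t - ε) t, σ s = σ s'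

/-- `SA Γ τD N₀` : switching signals with average dwell time `τD` and chatter bound `N₀`. -/
def SA (Γ : Type*) [TopologicalSpace Γ] (τD : ℝ) (N₀ : ℕ) : Set (ℝ → Γ) :=
  {σ | IsSwitchingSignal σ ∧ ∀ τ₁ τ₂ : ℝ, τ₁ < τ₂ →
    ((JumpTimes σ ∩ Set.Ioo τ₁ τ₂).ncard : ℝ) ≤ (N₀ : ℝ) + (τ₂ - τ₁) / τD}

def SAall (Γ : Type*) [TopologicalSpace Γ] : Set (ℝ → Γ) :=
  ⋃ τD ∈ Set.Ioi (0 : ℝ), ⋃ N₀ : ℕ, SA Γ τD N₀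

/-- Dwell-time signals. -/
def SD (Γ : Type*) [TopologicalSpace Γ] (τD : ℝ) : Set (ℝ → Γ) := SA Γ τD 1

def SDall (Γ : Type*) [TopologicalSpace Γ] : Set (ℝ → Γ) :=
  ⋃ τD ∈ Set.Ioi (0 : ℝ), SD Γ τD

/-- First switching time strictly greater than `t` (`⊤` if none). -/
def tau1 {Γ : Type*} [TopologicalSpace Γ] (σ : ℝ → Γ) (t : ℝ) : EReal :=
  sInf (Real.toEReal '' (JumpTimes σ ∩ Set.Ioi t))

/-- The class `S^H` of switching signals compatible with the set-valued map `H`: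
at each switching time the new value belongs to `H` of the left limit. -/
def SH {Γ : Type*} [TopologicalSpace Γ] (H : Γ → Set Γ) : Set (ℝ → Γ) :=
  {σ | ∀ t ∈ JumpTimes σ, ∀ γ' : Γ,
    Filter.Tendsto σ (nhdsWithin t (Set.Iio t)) (nhds γ') → σ t ∈ H γ'}

/-- The "ergodic" class `S_e[T]`. -/
def SE (Γ : Type*) [TopologicalSpace Γ] (T : ℝ) : Set (ℝ → Γ) :=
  {σ | ∀ t₀ : ℝ, 0 ≤ t₀ → ∀ γ : Γ, ∃ t ∈ Set.Icc t₀ (t₀ + T), σ t = γ}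

def SEall (Γ : Type*) [TopologicalSpace Γ] : Set (ℝ → Γ) :=
  ⋃ T ∈ Set.Ioi (0 : ℝ), SE Γ T

/-- Property P of a family of switching signals. -/
def HasPropertyP {Γ : Type*} [TopologicalSpace Γ] (S : Set (ℝ → Γ)) : Prop :=
  (∃ τD > (0 : ℝ), ∃ N₀ : ℕ, S ⊆ SA Γ τD N₀) ∧
  (∀ σ ∈ S, ∀ s > (0 : ℝ), (fun t => σ (t + s)) ∈ S) ∧
  (∀ σseq : ℕ → ℝ → Γ, (∀ k, σseq k ∈ S) →
    ∃ σstar ∈ S, ∃ φ : ℕ → ℕ, StrictMono φ ∧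
      ∀ᵐ t ∂(volume : Measure ℝ),
        Filter.Tendsto (fun l => σseq (φ l) t) Filter.atTop (nhds (σstar t)))

/-- A solution of `ẋ = g(x)` with values in `X`, on the set `I`. -/
def IsSolOn {n : ℕ} (g : Eucl n → Eucl n) (X : Set (Eucl n)) (φ : ℝ → Eucl n) (I : Set ℝ) : Prop :=
  ContinuousOn φ I ∧ (∀ t ∈ I, φ t ∈ X) ∧
  ∀ t₀ ∈ I, ∀ t ∈ I,
    IntervalIntegrable (fun s => g (φ s)) volume t₀ t ∧
    φ t = φ t₀ + ∫ s in t₀..t, g (φ s)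

/-- A trajectory of the switched system `ẋ = f(x,σ)` on the interval `I`. -/
structure IsTrajectory {n : ℕ} {Γ : Type*} [TopologicalSpace Γ]
    (f : Eucl n × Γ → Eucl n) (domf : Set (Eucl n × Γ))
    (x : ℝ → Eucl n) (σ : ℝ → Γ) (I : Set ℝ) : Prop where
  signal : IsSwitchingSignal σ
  nonempty : I.Nonempty
  ordConn : I.OrdConnected
  cont : ContinuousOn x I
  mem : ∀ t ∈ I, (x t, σ t) ∈ domf
  intg : ∀ t₀ ∈ I, ∀ t ∈ I,
    IntervalIntegrable (fun s => f (x s, σ s)) volume t₀ t ∧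
    x t = x t₀ + ∫ s in t₀..t, f (x s, σ s)

/-- Precompactness of a trajectory relative to `O`. -/
def PrecompactRel {n : ℕ} (x : ℝ → Eucl n) (I : Set ℝ) (O : Set (Eucl n)) : Prop :=
  ∃ B : Set (Eucl n), B ⊆ O ∧ IsCompact B ∧ ∀ t ∈ I, x t ∈ B

/-- ω-limit set of `x` defined on `I`. -/
def OmegaLimit {n : ℕ} (x : ℝ → Eucl n) (I : Set ℝ) : Set (Eucl n) :=
  {ξ | ∃ s : ℕ → ℝ, StrictMono s ∧ (∀ k, s k ∈ I) ∧
    Filter.Tendsto s Filter.atTop Filter.atTop ∧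
    Filter.Tendsto (fun k => x (s k)) Filter.atTop (nhds ξ)}

/-- The set `Ω♯(x,σ)`. -/
def OmegaSharp {n : ℕ} {Γ : Type*} [TopologicalSpace Γ] (x : ℝ → Eucl n) (σ : ℝ → Γ) :
    Set (Eucl n × Γ) :=
  {p | ∃ s : ℕ → ℝ, StrictMono s ∧ (∀ k, 0 ≤ s k) ∧
    Filter.Tendsto s Filter.atTop Filter.atTop ∧
    (∃ r : EReal, 0 < r ∧
      Filter.Tendsto (fun k => tau1 σ (s k) - Real.toEReal (s k)) Filter.atTop (nhds r)) ∧
    Filter.Tendsto (fun k => x (s k)) Filter.atTop (nhds p.1) ∧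
    Filter.Tendsto (fun k => σ (s k)) Filter.atTop (nhds p.2)}

/-- Weak invariance of `M` w.r.t. the family of complete trajectories `T`
(without the nonemptiness requirement). -/
def WeaklyInvariantCore {n : ℕ} {Γ : Type*} (T : Set ((ℝ → Eucl n) × (ℝ → Γ)))
    (M : Set (Eucl n × Γ)) : Prop :=
  ∀ p ∈ M, ∃ xs ∈ T, xs.1 0 = p.1 ∧ xs.2 0 = p.2 ∧ ∀ t : ℝ, (xs.1 t, xs.2 t) ∈ M

/-- Weak invariance of a nonempty set `M` w.r.t. `T`. -/
def WeaklyInvariant {n : ℕ} {Γ : Type*} (T : Set ((ℝ → Eucl n) × (ℝ → Γ)))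
    (M : Set (Eucl n × Γ)) : Prop :=
  M.Nonempty ∧ WeaklyInvariantCore T M

/-- Maximal weakly invariant subset of `S` w.r.t. `T`. -/
def MaxWeaklyInvariantIn {n : ℕ} {Γ : Type*} (T : Set ((ℝ → Eucl n) × (ℝ → Γ)))
    (S : Set (Eucl n × Γ)) : Set (Eucl n × Γ) :=
  ⋃₀ {M | M ⊆ S ∧ WeaklyInvariantCore T M}

/-- All complete trajectories whose switching signal lies in `S`. -/
def TrajOf {n : ℕ} {Γ : Type*} [TopologicalSpace Γ] (f : Eucl n × Γ → Eucl n)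
    (domf : Set (Eucl n × Γ)) (S : Set (ℝ → Γ)) : Set ((ℝ → Eucl n) × (ℝ → Γ)) :=
  {xs | IsTrajectory f domf xs.1 xs.2 Set.univ ∧ xs.2 ∈ S}

/-- `x → M` : convergence of `x(t)` to the set `M` as `t → +∞`. -/
def ConvergesTo {n : ℕ} (x : ℝ → Eucl n) (M : Set (Eucl n)) : Prop :=
  Filter.Tendsto (fun t => Metric.infDist (x t) M) Filter.atTop (nhds 0)

def Oset {n : ℕ} {Γ : Type*} (domV : Set (Eucl n × Γ)) : Set (Eucl n) := Prod.fst '' domV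

def Ogamma {n : ℕ} {Γ : Type*} (domV domf : Set (Eucl n × Γ)) (γ : Γ) : Set (Eucl n) :=
  {ξ | ξ ∈ Oset domV ∧ (ξ, γ) ∈ domf}

/-- The class 𝒱 of functions. -/
structure ClassVFun {n : ℕ} {Γ : Type*} (V : Eucl n × Γ → ℝ)
    (domV domf : Set (Eucl n × Γ)) : Prop where
  openD : ∀ γ : Γ, IsOpen {ξ : Eucl n | (ξ, γ) ∈ domV}
  subD : ∀ γ : Γ, ∀ ξ ∈ Ogamma domV domf γ, (ξ, γ) ∈ domV
  diff : ∀ γ : Γ, ∀ ξ ∈ Ogamma domV domf γ, DifferentiableAt ℝ (fun ξ' => V (ξ', γ)) ξ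

/-- The set `Z_V`. -/
def ZV {n : ℕ} {Γ : Type*} (f : Eucl n × Γ → Eucl n) (V : Eucl n × Γ → ℝ)
    (domV domf : Set (Eucl n × Γ)) : Set (Eucl n × Γ) :=
  {p | p ∈ domf ∧ p.1 ∈ Oset domV ∧ fderiv ℝ (fun ξ' => V (ξ', p.2)) p.1 (f p) = 0}

/-- Assumption (A1). -/
structure AssumptionA1 {n : ℕ} {Γ : Type*} [TopologicalSpace Γ]
    (domf : Set (Eucl n × Γ)) (V : Eucl n × Γ → ℝ) (domV : Set (Eucl n × Γ))
    (x : ℝ → Eucl n) (σ : ℝ → Γ) (I : Set ℝ) : Prop where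
  classV : ClassVFun V domV domf
  contV : ContinuousOn V (domf ∩ (Oset domV ×ˢ (Set.univ : Set Γ)))
  precompact : PrecompactRel x I (Oset domV)
  nonincr : AntitoneOn (fun t => V (x t, σ t)) (Set.Ici 0)

/-- Assumption (A2) (for finite Γ). -/
structure AssumptionA2 {n : ℕ} {Γ : Type*} [TopologicalSpace Γ]
    (domf : Set (Eucl n × Γ)) (V : Eucl n × Γ → ℝ) (domV : Set (Eucl n × Γ))
    (x : ℝ → Eucl n) (σ : ℝ → Γ) (I : Set ℝ) : Prop where
  classV : ClassVFun V domV domf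
  precompact : PrecompactRel x I (Oset domV)
  nonincr : ∀ γ : Γ, AntitoneOn (fun t => V (x t, σ t)) ({t | σ t = γ} ∩ Set.Ici 0)

/-- The inequality `−∇V_γ(ξ)·f_γ(ξ) ≥ W_γ(ξ) ≥ 0` on each `O_γ`. -/
def Wineq {n : ℕ} {Γ : Type*} (f : Eucl n × Γ → Eucl n) (V W : Eucl n × Γ → ℝ)
    (domV domf : Set (Eucl n × Γ)) : Prop :=
  ∀ γ : Γ, ∀ ξ ∈ Ogamma domV domf γ,
    W (ξ, γ) ≤ -(fderiv ℝ (fun ξ' => V (ξ', γ)) ξ (f (ξ, γ))) ∧ 0 ≤ W (ξ, γ)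

/-- Assumption (A4). -/
structure AssumptionA4 {n : ℕ} {Γ : Type*} [TopologicalSpace Γ] (f : Eucl n × Γ → Eucl n)
    (domf : Set (Eucl n × Γ)) (V : Eucl n × Γ → ℝ) (domV : Set (Eucl n × Γ))
    (W : Eucl n × Γ → ℝ) (x : ℝ → Eucl n) (σ : ℝ → Γ) (I : Set ℝ) : Prop where
  classV : ClassVFun V domV domf
  boundedV : ∀ K : Set (Eucl n × Γ), K ⊆ domf ∩ (Oset domV ×ˢ (Set.univ : Set Γ)) →
    IsCompact K → ∃ M : ℝ, ∀ p ∈ K, |V p| ≤ M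
  precompact : PrecompactRel x I (Oset domV)
  nonincr : AntitoneOn (fun t => V (x t, σ t)) (Set.Ici 0)
  wineq : Wineq f V W domV domf
  contW : ContinuousOn W (domf ∩ (Oset domV ×ˢ (Set.univ : Set Γ)))

/-- The set `X^f(g,h,τ)` for finite `τ`. -/
def XFwd {n : ℕ} (X : Set (Eucl n)) (g : Eucl n → Eucl n) (h : Eucl n → ℝ) (τ : ℝ) :
    Set (Eucl n) :=
  {ξ | ∃ φ : ℝ → Eucl n, IsSolOn g X φ (Set.Icc 0 τ) ∧ φ 0 = ξ ∧
    ∀ t ∈ Set.Icc (0 : ℝ) τ, h (φ t) = 0}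

/-- The set `X^b(g,h,τ)` for finite `τ`. -/
def XBwd {n : ℕ} (X : Set (Eucl n)) (g : Eucl n → Eucl n) (h : Eucl n → ℝ) (τ : ℝ) :
    Set (Eucl n) :=
  {ξ | ∃ φ : ℝ → Eucl n, IsSolOn g X φ (Set.Icc (-τ) 0) ∧ φ 0 = ξ ∧
    ∀ t ∈ Set.Icc (-τ) (0 : ℝ), h (φ t) = 0}

/-- The set `X^f(g,h,∞)`. -/
def XFwdInf {n : ℕ} (X : Set (Eucl n)) (g : Eucl n → Eucl n) (h : Eucl n → ℝ) :
    Set (Eucl n) :=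
  {ξ | ∃ φ : ℝ → Eucl n, IsSolOn g X φ (Set.Ici 0) ∧ φ 0 = ξ ∧
    ∀ t ∈ Set.Ici (0 : ℝ), h (φ t) = 0}

/-- The set `X^b(g,h,∞)`. -/
def XBwdInf {n : ℕ} (X : Set (Eucl n)) (g : Eucl n → Eucl n) (h : Eucl n → ℝ) :
    Set (Eucl n) :=
  {ξ | ∃ φ : ℝ → Eucl n, IsSolOn g X φ (Set.Iic 0) ∧ φ 0 = ξ ∧
    ∀ t ∈ Set.Iic (0 : ℝ), h (φ t) = 0}

/-- `X^f(g,h) = ∪_{τ>0} X^f(g,h,τ)`. -/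
def XFwdFin {n : ℕ} (X : Set (Eucl n)) (g : Eucl n → Eucl n) (h : Eucl n → ℝ) :
    Set (Eucl n) :=
  ⋃ τ ∈ Set.Ioi (0 : ℝ), XFwd X g h τ

/-- `X^b(g,h) = ∪_{τ>0} X^b(g,h,τ)`. -/
def XBwdFin {n : ℕ} (X : Set (Eucl n)) (g : Eucl n → Eucl n) (h : Eucl n → ℝ) :
    Set (Eucl n) :=
  ⋃ τ ∈ Set.Ioi (0 : ℝ), XBwd X g h τ

/-- Weakly meagre functions on `[0,∞)`. -/
def WeaklyMeagre (y : ℝ → ℝ) : Prop :=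
  ∀ I : ℕ → Set ℝ, (∀ k, (I k).Nonempty) → (∀ k, I k ⊆ Set.Ici 0) →
    (∀ k, (I k).OrdConnected) → (Pairwise fun k l => Disjoint (I k) (I l)) →
    (∃ δ : ENNReal, 0 < δ ∧ ∀ k, δ ≤ volume (I k)) →
    Filter.Tendsto (fun k => sInf ((fun t => |y t|) '' I k)) Filter.atTop (nhds 0)

/-- Assumption (E0) : the origin is an equilibrium point of the switched system. -/
def AssumpE0 {n : ℕ} {Γ : Type*} (f : Eucl n × Γ → Eucl n) (domf : Set (Eucl n × Γ)) : Prop :=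
  ∀ γ : Γ, ((0 : Eucl n), γ) ∈ domf → f (0, γ) = 0

/-- Assumption (U) : uniqueness of the solution of the IVP `ẋ = f_γ(x)`, `x(0)=0`. -/
def AssumpU {n : ℕ} {Γ : Type*} (f : Eucl n × Γ → Eucl n) (domf : Set (Eucl n × Γ)) : Prop :=
  ∀ γ : Γ, ((0 : Eucl n), γ) ∈ domf →
    ∀ I : Set ℝ, I.OrdConnected → (0 : ℝ) ∈ I →
    ∀ φ ψ : ℝ → Eucl n,
      IsSolOn (fun ξ => f (ξ, γ)) {ξ | (ξ, γ) ∈ domf} φ I →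
      IsSolOn (fun ξ => f (ξ, γ)) {ξ | (ξ, γ) ∈ domf} ψ I →
      φ 0 = 0 → ψ 0 = 0 → ∀ t ∈ I, φ t = ψ t

/-- The set `E_γ` of equilibrium points of `f_γ`. -/
def Egamma {n : ℕ} {Γ : Type*} (f : Eucl n × Γ → Eucl n) (domf : Set (Eucl n × Γ)) (γ : Γ) :
    Set (Eucl n) :=
  {ξ | (ξ, γ) ∈ domf ∧ f (ξ, γ) = 0}

/-- Discrete subsets of `ℝⁿ`. -/
def IsDiscreteSet {n : ℕ} (S : Set (Eucl n)) : Prop :=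
  ∀ ξ ∈ S, ∃ ε > (0 : ℝ), S ∩ Metric.ball ξ ε = {ξ}

/-- Class-K functions (on `[0,∞)`). -/
structure ClassK (α : ℝ → ℝ) : Prop where
  cont : ContinuousOn α (Set.Ici 0)
  mono : StrictMonoOn α (Set.Ici 0)
  zero : α 0 = 0

/-- Class-K∞ functions. -/
structure ClassKInf (α : ℝ → ℝ) extends ClassK α : Prop where
  unbounded : Filter.Tendsto α Filter.atTop Filter.atTop

/-- Local uniform stability of a family of forward complete trajectories. -/
def FamilyLUS {n : ℕ} {Γ : Type*} (T : Set ((ℝ → Eucl n) × (ℝ → Γ))) : Prop :=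
  ∃ r > (0 : ℝ), ∃ α : ℝ → ℝ, ClassK α ∧
    ∀ xs ∈ T, ∀ t₀ : ℝ, 0 ≤ t₀ → ‖xs.1 t₀‖ ≤ r → ∀ t : ℝ, t₀ ≤ t → ‖xs.1 t‖ ≤ α ‖xs.1 t₀‖

/-- Global uniform stability. -/
def FamilyGUS {n : ℕ} {Γ : Type*} (T : Set ((ℝ → Eucl n) × (ℝ → Γ))) : Prop :=
  ∃ α : ℝ → ℝ, ClassKInf α ∧
    ∀ xs ∈ T, ∀ t₀ : ℝ, 0 ≤ t₀ → ∀ t : ℝ, t₀ ≤ t → ‖xs.1 t‖ ≤ α ‖xs.1 t₀‖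

/-- Local asymptotic stability. -/
def FamilyLAS {n : ℕ} {Γ : Type*} (T : Set ((ℝ → Eucl n) × (ℝ → Γ))) : Prop :=
  FamilyLUS T ∧ ∃ η > (0 : ℝ), ∀ xs ∈ T, ‖xs.1 0‖ < η →
    Filter.Tendsto xs.1 Filter.atTop (nhds 0)

/-- Global asymptotic stability. -/
def FamilyGAS {n : ℕ} {Γ : Type*} (T : Set ((ℝ → Eucl n) × (ℝ → Γ))) : Prop :=
  FamilyGUS T ∧ ∀ xs ∈ T, Filter.Tendsto xs.1 Filter.atTop (nhds 0)

/-- A weak Lyapunov pair `(V,W)` for the family `T`. -/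
structure WeakLyapunovPair {n : ℕ} {Γ : Type*} [TopologicalSpace Γ]
    (f : Eucl n × Γ → Eucl n) (domf : Set (Eucl n × Γ)) (V : Eucl n × Γ → ℝ)
    (domV : Set (Eucl n × Γ)) (W : Eucl n × Γ → ℝ)
    (T : Set ((ℝ → Eucl n) × (ℝ → Γ))) : Prop where
  classV : ClassVFun V domV domf
  zeroMem : (0 : Eucl n) ∈ Oset domV
  bounds : ∃ α₁ α₂ : ℝ → ℝ, ClassK α₁ ∧ ClassK α₂ ∧
    ∀ γ : Γ, ∀ ξ ∈ Ogamma domV domf γ, α₁ ‖ξ‖ ≤ V (ξ, γ) ∧ V (ξ, γ) ≤ α₂ ‖ξ‖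
  wineq : Wineq f V W domV domf
  decreasing : ∀ xs ∈ T, ∀ a b : ℝ, 0 ≤ a → a ≤ b →
    (∀ t ∈ Set.Icc a b, xs.1 t ∈ Oset domV) →
    AntitoneOn (fun t => V (xs.1 t, xs.2 t)) (Set.Icc a b)

/-- An F-weak Lyapunov pair `(V,W)` for the family `T`. -/
structure FWeakLyapunovPair {n : ℕ} {Γ : Type*} [TopologicalSpace Γ]
    (f : Eucl n × Γ → Eucl n) (domf : Set (Eucl n × Γ)) (V : Eucl n × Γ → ℝ)
    (domV : Set (Eucl n × Γ)) (W : Eucl n × Γ → ℝ)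
    (T : Set ((ℝ → Eucl n) × (ℝ → Γ))) : Prop where
  classV : ClassVFun V domV domf
  zeroMem : (0 : Eucl n) ∈ Oset domV
  bounds : ∃ α₁ α₂ : ℝ → ℝ, ClassK α₁ ∧ ClassK α₂ ∧
    ∀ γ : Γ, ∀ ξ ∈ Ogamma domV domf γ, α₁ ‖ξ‖ ≤ V (ξ, γ) ∧ V (ξ, γ) ≤ α₂ ‖ξ‖
  wineq : Wineq f V W domV domf
  decreasing : ∀ xs ∈ T, ∀ a b : ℝ, 0 ≤ a → a ≤ b →
    (∀ t ∈ Set.Icc a b, xs.1 t ∈ Oset domV) →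
    ∀ γ : Γ, AntitoneOn (fun t => V (xs.1 t, γ)) (Set.Icc a b ∩ {t | xs.2 t = γ})

/-- `V` is radially unbounded : the class-K bounds may be chosen of class K∞. -/
def RadiallyUnbounded {n : ℕ} {Γ : Type*} (V : Eucl n × Γ → ℝ)
    (domV domf : Set (Eucl n × Γ)) : Prop :=
  ∃ α₁ α₂ : ℝ → ℝ, ClassKInf α₁ ∧ ClassKInf α₂ ∧
    ∀ γ : Γ, ∀ ξ ∈ Ogamma domV domf γ, α₁ ‖ξ‖ ≤ V (ξ, γ) ∧ V (ξ, γ) ≤ α₂ ‖ξ‖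

/-- Simple cycle `{γ_i}_{i=1}^m` of the set-valued map `H`. -/
def IsSimpleCycle {Γ : Type*} (H : Γ → Set Γ) (m : ℕ) (γs : ℕ → Γ) : Prop :=
  3 ≤ m ∧ γs 1 = γs m ∧ (∀ i, 1 ≤ i → i < m → γs (i + 1) ∈ H (γs i)) ∧
  ∀ i j, 1 ≤ i → i < j → j ≤ m → γs i = γs j → i = 1 ∧ j = m

/-- A family of forward complete trajectories of the switched system. -/
def ForwardCompleteFamily {n : ℕ} {Γ : Type*} [TopologicalSpace Γ]
    (f : Eucl n × Γ → Eucl n) (domf : Set (Eucl n × Γ))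
    (T : Set ((ℝ → Eucl n) × (ℝ → Γ))) : Prop :=
  ∀ xs ∈ T, ∃ I : Set ℝ, Set.Ici (0 : ℝ) ⊆ I ∧ IsTrajectory f domf xs.1 xs.2 I

/-- Condition (a) : `O_γ^f(f_γ,W_γ,∞) ∩ O_γ^b(f_γ,W_γ,∞) ⊆ {0}` for every `γ`. -/
def CondA {n : ℕ} {Γ : Type*} (f : Eucl n × Γ → Eucl n)
    (domf domV : Set (Eucl n × Γ)) (W : Eucl n × Γ → ℝ) : Prop :=
  ∀ γ : Γ, XFwdInf (Ogamma domV domf γ) (fun ξ => f (ξ, γ)) (fun ξ => W (ξ, γ)) ∩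
    XBwdInf (Ogamma domV domf γ) (fun ξ => f (ξ, γ)) (fun ξ => W (ξ, γ)) ⊆ {0}

/-- Condition (b) : `O_γ^b(f_γ,W_γ) ∩ O_{γ'}^f(f_{γ'},W_{γ'}) ⊆ {0}` for `γ ≠ γ'`. -/
def CondB {n : ℕ} {Γ : Type*} (f : Eucl n × Γ → Eucl n)
    (domf domV : Set (Eucl n × Γ)) (W : Eucl n × Γ → ℝ) : Prop :=
  ∀ γ γ' : Γ, γ ≠ γ' →
    XBwdFin (Ogamma domV domf γ) (fun ξ => f (ξ, γ)) (fun ξ => W (ξ, γ)) ∩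
    XFwdFin (Ogamma domV domf γ') (fun ξ => f (ξ, γ')) (fun ξ => W (ξ, γ')) ⊆ {0}

/-- Condition (b') : the variant of (b) involving the level sets of `V`. -/
def CondB' {n : ℕ} {Γ : Type*} (f : Eucl n × Γ → Eucl n) (V : Eucl n × Γ → ℝ)
    (domf domV : Set (Eucl n × Γ)) (W : Eucl n × Γ → ℝ) : Prop :=
  ∀ γ γ' : Γ, γ ≠ γ' → ∀ c : ℝ,
    XBwdFin (Ogamma domV domf γ) (fun ξ => f (ξ, γ)) (fun ξ => W (ξ, γ)) ∩
    XFwdFin (Ogamma domV domf γ') (fun ξ => f (ξ, γ')) (fun ξ => W (ξ, γ')) ∩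
    {ξ : Eucl n | V (ξ, γ) = c} ∩ {ξ : Eucl n | V (ξ, γ') = c} ⊆ {0}

/-- Condition (i) of the cycle theorems :
either all the forward infinite-horizon sets, or all the backward ones, reduce to `{0}`. -/
def CondI {n : ℕ} {Γ : Type*} (f : Eucl n × Γ → Eucl n)
    (domf domV : Set (Eucl n × Γ)) (W : Eucl n × Γ → ℝ) : Prop :=
  (∀ γ : Γ, XFwdInf (Ogamma domV domf γ) (fun ξ => f (ξ, γ)) (fun ξ => W (ξ, γ)) ⊆ {0}) ∨
  (∀ γ : Γ, XBwdInf (Ogamma domV domf γ) (fun ξ => f (ξ, γ)) (fun ξ => W (ξ, γ)) ⊆ {0})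

/-- Condition (ii) on simple cycles of `H`. -/
def CondCycle {n : ℕ} {Γ : Type*} (f : Eucl n × Γ → Eucl n)
    (domf domV : Set (Eucl n × Γ)) (W : Eucl n × Γ → ℝ) (H : Γ → Set Γ) : Prop :=
  ∀ m : ℕ, ∀ γs : ℕ → Γ, IsSimpleCycle H m γs →
    ∃ j : ℕ, 1 ≤ j ∧ j < m ∧
      XBwdFin (Ogamma domV domf (γs j)) (fun ξ => f (ξ, γs j)) (fun ξ => W (ξ, γs j)) ∩
      XFwdFin (Ogamma domV domf (γs (j + 1))) (fun ξ => f (ξ, γs (j + 1)))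
        (fun ξ => W (ξ, γs (j + 1))) ⊆ {0}

/-- Condition (iii) on simple cycles of `H`, involving the level sets of `V`. -/
def CondCycle' {n : ℕ} {Γ : Type*} (f : Eucl n × Γ → Eucl n) (V : Eucl n × Γ → ℝ)
    (domf domV : Set (Eucl n × Γ)) (W : Eucl n × Γ → ℝ) (H : Γ → Set Γ) : Prop :=
  ∀ c : ℝ, ∀ m : ℕ, ∀ γs : ℕ → Γ, IsSimpleCycle H m γs →
    ∃ j : ℕ, 1 ≤ j ∧ j < m ∧
      XBwdFin (Ogamma domV domf (γs j)) (fun ξ => f (ξ, γs j)) (fun ξ => W (ξ, γs j)) ∩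
      XFwdFin (Ogamma domV domf (γs (j + 1))) (fun ξ => f (ξ, γs (j + 1)))
        (fun ξ => W (ξ, γs (j + 1))) ∩
      {ξ : Eucl n | V (ξ, γs j) = c} ∩ {ξ : Eucl n | V (ξ, γs (j + 1)) = c} ⊆ {0}

/-- For every `γ`, `O_γ^b(f_γ,W_γ) = E_γ ∩ O_γ` or `O_γ^f(f_γ,W_γ) = E_γ ∩ O_γ`. -/
def CondEquilObs {n : ℕ} {Γ : Type*} (f : Eucl n × Γ → Eucl n)
    (domf domV : Set (Eucl n × Γ)) (W : Eucl n × Γ → ℝ) : Prop :=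
  ∀ γ : Γ,
    XBwdFin (Ogamma domV domf γ) (fun ξ => f (ξ, γ)) (fun ξ => W (ξ, γ)) =
      Egamma f domf γ ∩ Ogamma domV domf γ ∨
    XFwdFin (Ogamma domV domf γ) (fun ξ => f (ξ, γ)) (fun ξ => W (ξ, γ)) =
      Egamma f domf γ ∩ Ogamma domV domf γ

end


/-- A signal without jumps in `(a,b)` is constant on `[a,b)`. -/
theorem aux_const {Γ : Type*} [MetricSpace Γ] {σ : ℝ → Γ} (hσ : IsSwitchingSignal σ)
    {a b : ℝ} (h : ∀ u ∈ Ioo a b, ContinuousAt σ u) {s : ℝ} (hs : s ∈ Ico a b) :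
    σ s = σ a := by
  have hright : ∀ t, σ ⁻¹' {σ t} ∈ 𝓝[≥] t := by
    intro t
    obtain ⟨ε, hε, h1⟩ := hσ.rightConst t
    exact Filter.mem_of_superset (Ico_mem_nhdsGE (by linarith)) (fun u hu => h1 u hu)
  have hcont : ContinuousOn σ (Icc a s) := by
    intro u hu
    rcases eq_or_lt_of_le hu.1 with h1 | h1
    · subst h1
      have h2 : ContinuousWithinAt σ (Ici a) a := by
        refine tendsto_const_nhds.congr' ?_
        filter_upwards [hright a] with v hv
        exact hv.symm
      exact h2.mono Icc_subset_Ici_self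
    · exact (h u ⟨h1, lt_of_le_of_lt hu.2 hs.2⟩).continuousWithinAt
  have hcl : IsClosed (σ ⁻¹' {σ a} ∩ Icc a s) := by
    rw [Set.inter_comm]
    exact hcont.preimage_isClosed_of_isClosed isClosed_Icc isClosed_singleton
  have := hcl.Icc_subset_of_forall_mem_nhdsWithin (by simp) (by
    intro u hu
    have h1 := hright u
    have h2 : σ u = σ a := hu.1
    rw [h2] at h1
    exact nhdsWithin_mono _ Ioi_subset_Ici_self h1)
  exact this ⟨hs.1, le_rfl⟩

/-- Uniformly bounded number of jumps: frequently there is a gap close to `t`. -/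
theorem aux_gap {Γ : Type*} [MetricSpace Γ] (σs : ℕ → ℝ → Γ) (N : ℕ) (t : ℝ)
    (hfin : ∀ k, (JumpTimes (σs k) ∩ Ioo t (t + 1)).Finite)
    (hN : ∀ k, (JumpTimes (σs k) ∩ Ioo t (t + 1)).ncard ≤ N) :
    ∃ δ₀ > (0 : ℝ), ∀ δ, 0 < δ → δ < δ₀ →
      ∃ᶠ k in atTop, ∀ u ∈ Ioo (t + δ) (t + δ₀), ContinuousAt (σs k) u := by
  classical
  let P : ℕ → Prop := fun m => ∃ δ : ℝ, 0 < δ ∧ δ ≤ 1 ∧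
    ∃ᶠ k in atTop, (JumpTimes (σs k) ∩ Ioo t (t + δ)).ncard ≤ m
  have hP : ∃ m, P m := ⟨N, 1, one_pos, le_rfl, Frequently.of_forall hN⟩
  obtain ⟨δ₀, h0, h1, hfr⟩ := Nat.find_spec hP
  refine ⟨δ₀, h0, fun δ hδ hδ0 => ?_⟩
  have hev : ∀ᶠ k in atTop, Nat.find hP ≤ (JumpTimes (σs k) ∩ Ioo t (t + δ)).ncard := by
    by_contra hcon
    rw [Filter.not_eventually] at hcon
    have hpos : 0 < Nat.find hP := by
      obtain ⟨k, hk⟩ := hcon.exists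
      omega
    refine Nat.find_min hP (Nat.sub_lt hpos one_pos) ⟨δ, hδ, by linarith, ?_⟩
    refine hcon.mono (fun k hk => ?_)
    omega
  refine (hfr.and_eventually hev).mono ?_
  rintro k ⟨hk1, hk2⟩ u hu
  have hsub : JumpTimes (σs k) ∩ Ioo t (t + δ) ⊆ JumpTimes (σs k) ∩ Ioo t (t + δ₀) :=
    inter_subset_inter_right _ (Ioo_subset_Ioo_right (by linarith))
  have hf : (JumpTimes (σs k) ∩ Ioo t (t + δ₀)).Finite :=
    (hfin k).subset (inter_subset_inter_right _ (Ioo_subset_Ioo_right (by linarith)))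
  have heq := Set.eq_of_subset_of_ncard_le hsub (hk1.trans hk2) hf
  by_contra hc
  have hmem : u ∈ JumpTimes (σs k) ∩ Ioo t (t + δ₀) := ⟨hc, by linarith [hu.1], hu.2⟩
  rw [← heq] at hmem
  linarith [hmem.2.2, hu.1]

theorem aux_tau_ge {Γ : Type*} [MetricSpace Γ] {σ : ℝ → Γ} {s δ : ℝ}
    (h : ∀ u ∈ Ioo s (s + δ), ContinuousAt σ u) :
    (δ : EReal) ≤ tau1 σ s - (s : EReal) := by
  have h1 : ((s + δ : ℝ) : EReal) ≤ tau1 σ s := by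
    refine le_sInf ?_
    rintro _ ⟨u, ⟨hu, hu'⟩, rfl⟩
    rw [EReal.coe_le_coe_iff]
    by_contra hc
    exact hu (h u ⟨hu', not_le.1 hc⟩)
  have h2 := EReal.sub_le_sub h1 (le_refl (s : EReal))
  refine le_trans ?_ h2
  rw [← EReal.coe_sub, EReal.coe_le_coe_iff]
  linarith

theorem aux_tau_lt {Γ : Type*} [MetricSpace Γ] {σ : ℝ → Γ} {s δ : ℝ}
    (h : (δ : EReal) < tau1 σ s - (s : EReal)) :
    ∀ u ∈ Ioo s (s + δ), ContinuousAt σ u := by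
  intro u hu
  by_contra hc
  have h1 : tau1 σ s ≤ (u : EReal) := sInf_le ⟨u, ⟨hc, hu.1⟩, rfl⟩
  have h2 := lt_of_lt_of_le h (EReal.sub_le_sub h1 (le_refl (s : EReal)))
  rw [← EReal.coe_sub, EReal.coe_lt_coe_iff] at h2
  linarith [hu.2]

theorem aux_mem {n : ℕ} {Γ : Type*} [MetricSpace Γ] {x : ℝ → Eucl n} {σ : ℝ → Γ}
    {p : Eucl n × Γ} {δ : ℝ} (hδ : 0 < δ)
    (h : ∀ ε > (0 : ℝ), ∀ T : ℝ, ∃ s ≥ T, (∀ u ∈ Ioo s (s + δ), ContinuousAt σ u) ∧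
      dist (x s) p.1 < ε ∧ dist (σ s) p.2 < ε) : p ∈ OmegaSharp x σ := by
  choose g hg1 hg2 hg3 hg4 using fun (ε : {ε : ℝ // 0 < ε}) => h ε.1 ε.2
  let e : ℕ → {ε : ℝ // 0 < ε} := fun j => ⟨1 / ((j : ℝ) + 1), by positivity⟩
  let s : ℕ → ℝ := fun j => Nat.rec (g (e 0) 0) (fun j r => g (e (j + 1)) (max (r + 1) (j + 1))) j
  have hsucc : ∀ j, s (j + 1) = g (e (j + 1)) (max (s j + 1) (j + 1)) := fun j => rfl
  have hsg : ∀ j : ℕ, ∃ T : ℝ, (j : ℝ) ≤ T ∧ s j = g (e j) T := by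
    intro j
    cases j with
    | zero => exact ⟨0, by simp, rfl⟩
    | succ j => exact ⟨max (s j + 1) (j + 1), by push_cast; exact le_max_right _ _, rfl⟩
  have hmono : StrictMono s := by
    refine strictMono_nat_of_lt_succ (fun j => ?_)
    have := (le_max_left (s j + 1) ((j : ℝ) + 1)).trans (hg1 (e (j + 1)) _)
    rw [hsucc]
    linarith
  have hge : ∀ j : ℕ, (j : ℝ) ≤ s j := by
    intro j
    obtain ⟨T, hT, hs⟩ := hsg j
    rw [hs]
    exact hT.trans (hg1 _ _)
  have htop : Tendsto s atTop atTop := tendsto_atTop_mono hge tendsto_natCast_atTop_atTop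
  have he : Tendsto (fun j : ℕ => 1 / ((j : ℝ) + 1)) atTop (𝓝 0) :=
    tendsto_one_div_add_atTop_nhds_zero_nat
  have hx : Tendsto (fun j => x (s j)) atTop (𝓝 p.1) := by
    rw [tendsto_iff_dist_tendsto_zero]
    refine squeeze_zero (fun _ => dist_nonneg) (fun j => ?_) he
    obtain ⟨T, hT, hs⟩ := hsg j
    rw [hs]
    exact (hg3 (e j) T).le
  have hσ' : Tendsto (fun j => σ (s j)) atTop (𝓝 p.2) := by
    rw [tendsto_iff_dist_tendsto_zero]
    refine squeeze_zero (fun _ => dist_nonneg) (fun j => ?_) he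
    obtain ⟨T, hT, hs⟩ := hsg j
    rw [hs]
    exact (hg4 (e j) T).le
  have hgap : ∀ j : ℕ, (δ : EReal) ≤ tau1 σ (s j) - Real.toEReal (s j) := by
    intro j
    obtain ⟨T, hT, hs⟩ := hsg j
    rw [hs]
    exact aux_tau_ge (hg2 (e j) T)
  obtain ⟨r, -, φ, hφ, hr⟩ := (isCompact_univ (X := EReal)).tendsto_subseq
    (x := fun j : ℕ => tau1 σ (s j) - Real.toEReal (s j)) (fun _ => mem_univ _)
  refine ⟨s ∘ φ, hmono.comp hφ, fun k => (Nat.cast_nonneg _).trans (hge (φ k)),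
    htop.comp hφ.tendsto_atTop, ⟨r, ?_, hr⟩, hx.comp hφ.tendsto_atTop,
    hσ'.comp hφ.tendsto_atTop⟩
  have h1 : (δ : EReal) ≤ r := ge_of_tendsto' hr (fun k => hgap (φ k))
  exact lt_of_lt_of_le (EReal.coe_pos.2 hδ) h1

/-- Pointwise convergent subsequence of an equi-Lipschitz sequence in a compact set. -/
theorem aux_arzela {n : ℕ} {B : Set (Eucl n)} (hB : IsCompact B) {L : ℝ} (y : ℕ → ℝ → Eucl n)
    (hy : ∀ k t, y k t ∈ B) (hL : ∀ k a b, dist (y k a) (y k b) ≤ L * |a - b|) (hL0 : 0 ≤ L) :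
    ∃ z : ℝ → Eucl n, ∃ φ : ℕ → ℕ, StrictMono φ ∧
      ∀ t, Tendsto (fun l => y (φ l) t) atTop (𝓝 (z t)) := by
  have hc : IsCompact (Set.pi univ (fun _ : ℚ => B)) := isCompact_univ_pi (fun _ => hB)
  obtain ⟨w, -, φ, hφ, hw⟩ := hc.tendsto_subseq (x := fun k (q : ℚ) => y k q)
    (fun k q _ => hy k q)
  rw [tendsto_pi_nhds] at hw
  have hlim : ∀ t, ∃ z, Tendsto (fun l => y (φ l) t) atTop (𝓝 z) := by
    intro t
    refine cauchySeq_tendsto_of_complete ?_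
    rw [Metric.cauchySeq_iff']
    intro ε hε
    obtain ⟨q, hq1, hq2⟩ := exists_rat_btwn (show t < t + ε / (4 * (L + 1)) by
      have : 0 < ε / (4 * (L + 1)) := by positivity
      linarith)
    have hq : L * |t - q| ≤ ε / 4 := by
      rw [abs_sub_comm, abs_of_pos (by linarith)]
      have h1 : (q : ℝ) - t ≤ ε / (4 * (L + 1)) := by linarith
      calc L * (q - t) ≤ (L + 1) * (ε / (4 * (L + 1))) := by
            apply mul_le_mul (by linarith) h1 (by linarith) (by linarith)
        _ = ε / 4 := by field_simp
    obtain ⟨N, hN⟩ := Metric.cauchySeq_iff'.1 (hw q).cauchySeq (ε / 4) (by positivity)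
    refine ⟨N, fun l hl => ?_⟩
    have h1 := hL (φ l) t q
    have h2 := hL (φ N) t q
    have h3 := hN l hl
    simp only [Function.comp] at h3
    have h4 := dist_triangle4 (y (φ l) t) (y (φ l) q) (y (φ N) q) (y (φ N) t)
    rw [dist_comm (y (φ N) q) (y (φ N) t)] at h4
    linarith
  choose z hz using hlim
  exact ⟨z, φ, hφ, hz⟩

theorem aux_ae_point {p : ℝ → Prop} (h : ∀ᵐ t ∂(volume : Measure ℝ), p t) {a b : ℝ}
    (hab : a < b) : ∃ t ∈ Ioo a b, p t := by
  by_contra hc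
  push Not at hc
  have h1 : volume (Ioo a b) = 0 := measure_mono_null (fun t ht => hc t ht) h
  rw [Real.volume_Ioo, ENNReal.ofReal_eq_zero] at h1
  linarith

theorem aux_contAt_shift {Γ : Type*} [MetricSpace Γ] {σ : ℝ → Γ} {s a b : ℝ}
    (h : ∀ u ∈ Ioo a b, ContinuousAt (fun t => σ (t + s)) u) :
    ∀ u ∈ Ioo (a + s) (b + s), ContinuousAt σ u := by
  intro u hu
  have h1 := h (u - s) ⟨by linarith [hu.1], by linarith [hu.2]⟩
  have h2 : ContinuousAt (fun v : ℝ => v - s) u := by fun_prop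
  have h3 : ContinuousAt ((fun t => σ (t + s)) ∘ (fun v : ℝ => v - s)) u :=
    ContinuousAt.comp h1 h2
  refine h3.congr (Eventually.of_forall (fun v => ?_))
  simp

/-- The switching signals of a family with property P: gap lemma. -/
theorem aux_gap_P {Γ : Type*} [MetricSpace Γ] {S : Set (ℝ → Γ)} (hP : HasPropertyP S)
    (σs : ℕ → ℝ → Γ) (hσs : ∀ k, σs k ∈ S) (t : ℝ) :
    ∃ δ₀ > (0 : ℝ), ∀ δ, 0 < δ → δ < δ₀ →
      ∃ᶠ k in atTop, ∀ u ∈ Ioo (t + δ) (t + δ₀), ContinuousAt (σs k) u := by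
  obtain ⟨⟨τD, hτ, N₀, hSA⟩, -, -⟩ := hP
  refine aux_gap σs ⌈(N₀ : ℝ) + 1 / τD⌉₊ t (fun k => ?_) (fun k => ?_)
  · exact ((hSA (hσs k)).1.locFinite t (t + 1)).subset
      (inter_subset_inter_right _ Ioo_subset_Icc_self)
  · have h1 := (hSA (hσs k)).2 t (t + 1) (by linarith)
    have h2 : (N₀ : ℝ) + (t + 1 - t) / τD = N₀ + 1 / τD := by ring
    rw [h2] at h1
    exact_mod_cast h1.trans (Nat.le_ceil _)

theorem aux_nonempty {n : ℕ} {Γ : Type*} [MetricSpace Γ] [CompactSpace Γ]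
    {S : Set (ℝ → Γ)} (hP : HasPropertyP S) {σ : ℝ → Γ} (hσ : σ ∈ S)
    {X : ℝ → Eucl n} {B : Set (Eucl n)} (hB : IsCompact B) (hX : ∀ t, X t ∈ B) :
    (OmegaSharp X σ).Nonempty := by
  obtain ⟨δ₀, h0, hgap⟩ := aux_gap_P hP (fun k t => σ (t + ((k : ℝ) + 1)))
    (fun k => hP.2.1 σ hσ _ (by positivity)) 0
  have hfr := hgap (δ₀ / 2) (by linarith) (by linarith)
  have hex : ∀ j : ℕ, ∃ s : ℝ, (j : ℝ) ≤ s ∧ ∀ u ∈ Ioo s (s + δ₀ / 2), ContinuousAt σ u := by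
    intro j
    obtain ⟨k, hk, hk2⟩ := (hfr.and_eventually (eventually_ge_atTop j)).exists
    have hk2' : (j : ℝ) ≤ k := by exact_mod_cast hk2
    refine ⟨0 + δ₀ / 2 + (k + 1), by linarith, fun u hu => ?_⟩
    refine aux_contAt_shift hk u ⟨hu.1, ?_⟩
    linarith [hu.2]
  choose s hs1 hs2 using hex
  obtain ⟨p, -, φ, hφ, hp⟩ := (hB.prod (isCompact_univ (X := Γ))).tendsto_subseq
    (x := fun j => (X (s j), σ (s j))) (fun j => ⟨hX _, mem_univ _⟩)
  refine ⟨p, aux_mem (δ := δ₀ / 2) (by linarith) (fun ε hε T => ?_)⟩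
  have h1 := (Metric.tendsto_nhds.1 hp) ε hε
  have h2 : ∀ᶠ l in atTop, T ≤ ((φ l : ℕ) : ℝ) :=
    (tendsto_natCast_atTop_atTop.comp hφ.tendsto_atTop).eventually_ge_atTop T
  obtain ⟨l, hl1, hl2⟩ := (h1.and h2).exists
  rw [Function.comp, Prod.dist_eq, max_lt_iff] at hl1
  exact ⟨s (φ l), hl2.trans (hs1 _), hs2 _, hl1.1, hl1.2⟩

theorem aux_core {n : ℕ} {Γ : Type*} [MetricSpace Γ] [CompactSpace Γ]
    (f : Eucl n × Γ → Eucl n) (domf : Set (Eucl n × Γ))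
    (hdomf : IsClosed domf) (hf : ContinuousOn f domf)
    (S : Set (ℝ → Γ)) (hP : HasPropertyP S) (X : ℝ → Eucl n) (σ : ℝ → Γ) (hσ : σ ∈ S)
    {B : Set (Eucl n)} (hB : IsCompact B) (hX : ∀ t, X t ∈ B) {L : ℝ} (hL0 : 0 ≤ L)
    (hL : ∀ a b, dist (X a) (X b) ≤ L * |a - b|)
    (hmem : ∀ t, 0 ≤ t → (X t, σ t) ∈ domf)
    (hfL : ∀ t, 0 ≤ t → ‖f (X t, σ t)‖ ≤ L)
    (hintg : ∀ a b, 0 ≤ a → 0 ≤ b → IntervalIntegrable (fun s => f (X s, σ s)) volume a b ∧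
      X b = X a + ∫ s in a..b, f (X s, σ s)) :
    WeaklyInvariantCore (TrajOf f domf S) (OmegaSharp X σ) := by
  rintro ⟨ξ, γ⟩ ⟨s₀, hs₀m, hs₀p, hs₀t, ⟨r, hr, hrt⟩, hsx, hsσ⟩
  have hSsig : ∀ τ ∈ S, IsSwitchingSignal τ := by
    obtain ⟨⟨τD, hτ, N₀, hSA⟩, -, -⟩ := hP
    exact fun τ hτ => (hSA hτ).1
  -- shift the sequence so that it is positive
  have hpos : ∀ k, 0 < s₀ (k + 1) := fun k =>
    lt_of_le_of_lt (hs₀p k) (hs₀m (Nat.lt_succ_self k))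
  obtain ⟨σs, hσs, φ₁, hφ₁, hae₁⟩ := hP.2.2 (fun k t => σ (t + s₀ (k + 1)))
    (fun k => hP.2.1 σ hσ _ (hpos k))
  obtain ⟨z, φ₂, hφ₂, hz⟩ := aux_arzela hB (L := L)
    (fun k t => X (t + s₀ (φ₁ k + 1))) (fun k t => hX _)
    (fun k a b => by simpa using hL (a + s₀ (φ₁ k + 1)) (b + s₀ (φ₁ k + 1))) hL0
  -- final sequence
  obtain ⟨ψ, hψ⟩ : ∃ ψ : ℕ → ℕ, ψ = fun k => φ₁ (φ₂ k) + 1 := ⟨_, rfl⟩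
  have hψt : Tendsto ψ atTop atTop := by
    rw [hψ]
    exact (tendsto_add_atTop_nat 1).comp ((hφ₁.comp hφ₂).tendsto_atTop)
  obtain ⟨s, hs⟩ : ∃ s : ℕ → ℝ, s = fun k => s₀ (ψ k) := ⟨_, rfl⟩
  have hst : Tendsto s atTop atTop := by rw [hs]; exact hs₀t.comp hψt
  have hspos : ∀ k, 0 < s k := fun k => by rw [hs, hψ]; exact hpos _
  have hzt : ∀ t, Tendsto (fun k => X (t + s k)) atTop (𝓝 (z t)) := by
    intro t
    have := hz t
    rw [hs, hψ]
    exact this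
  have hae : ∀ᵐ t ∂(volume : Measure ℝ), Tendsto (fun k => σ (t + s k)) atTop (𝓝 (σs t)) := by
    filter_upwards [hae₁] with t ht
    rw [hs, hψ]
    exact ht.comp hφ₂.tendsto_atTop
  have hrt' : Tendsto (fun k => tau1 σ (s k) - Real.toEReal (s k)) atTop (𝓝 r) := by
    rw [hs]; exact hrt.comp hψt
  have hsx' : Tendsto (fun k => X (s k)) atTop (𝓝 ξ) := by rw [hs]; exact hsx.comp hψt
  have hsσ' : Tendsto (fun k => σ (s k)) atTop (𝓝 γ) := by rw [hs]; exact hsσ.comp hψt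
  clear hψ hs hz hae₁ hrt hsx hsσ
  have hsig := hSsig σs hσs
  -- Lipschitz limit
  have hzL : ∀ a b, dist (z a) (z b) ≤ L * |a - b| := by
    intro a b
    refine le_of_tendsto' ((hzt a).dist (hzt b)) (fun k => ?_)
    simpa using hL (a + s k) (b + s k)
  have hzc : Continuous z := by
    refine (LipschitzWith.of_dist_le_mul (K := ⟨L, hL0⟩) (fun a b => ?_)).continuous
    rw [Real.dist_eq]
    exact hzL a b
  have hnn : ∀ t, ∀ᶠ k in atTop, 0 ≤ t + s k := by
    intro t
    filter_upwards [hst.eventually_ge_atTop (-t)] with k hk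
    linarith
  have hpair : ∀ᵐ t ∂(volume : Measure ℝ),
      Tendsto (fun k => (X (t + s k), σ (t + s k))) atTop (𝓝[domf] (z t, σs t)) := by
    filter_upwards [hae] with t ht
    refine tendsto_nhdsWithin_iff.2 ⟨(hzt t).prodMk_nhds ht, ?_⟩
    filter_upwards [hnn t] with k hk using hmem _ hk
  have hmem_ae : ∀ᵐ t ∂(volume : Measure ℝ), (z t, σs t) ∈ domf := by
    filter_upwards [hpair] with t ht
    have h2 := tendsto_nhdsWithin_iff.1 ht
    exact hdomf.mem_of_tendsto h2.1 h2.2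
  have hfconv : ∀ᵐ t ∂(volume : Measure ℝ),
      Tendsto (fun k => f (X (t + s k), σ (t + s k))) atTop (𝓝 (f (z t, σs t))) := by
    filter_upwards [hpair, hmem_ae] with t ht hm
    exact (hf _ hm).tendsto.comp ht
  have hfbd : ∀ᵐ t ∂(volume : Measure ℝ), ‖f (z t, σs t)‖ ≤ L := by
    filter_upwards [hfconv] with t ht
    refine le_of_tendsto ht.norm ?_
    filter_upwards [hnn t] with k hk using hfL _ hk
  have hmem_all : ∀ t, (z t, σs t) ∈ domf := by
    intro t
    obtain ⟨ε, hε, hconst⟩ := hsig.rightConst t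
    have hpt : ∀ j : ℕ, ∃ u ∈ Ioo t (t + ε / ((j : ℝ) + 1)), (z u, σs u) ∈ domf := by
      intro j
      refine aux_ae_point hmem_ae ?_
      have : 0 < ε / ((j : ℝ) + 1) := by positivity
      linarith
    choose u hu hu2 using hpt
    have hut : Tendsto u atTop (𝓝 t) := by
      have h1 : Tendsto (fun j : ℕ => t + ε / ((j : ℝ) + 1)) atTop (𝓝 t) := by
        have := (tendsto_one_div_add_atTop_nhds_zero_nat (𝕜 := ℝ)).const_mul ε
        simpa [mul_one_div, div_eq_mul_inv] using this.const_add t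
      exact tendsto_of_tendsto_of_tendsto_of_le_of_le tendsto_const_nhds h1
        (fun j => (hu j).1.le) (fun j => (hu j).2.le)
    have h2 : Tendsto (fun j => (z (u j), σs t)) atTop (𝓝 (z t, σs t)) :=
      ((hzc.tendsto t).comp hut).prodMk_nhds tendsto_const_nhds
    refine hdomf.mem_of_tendsto h2 (Eventually.of_forall (fun j => ?_))
    have h3 : u j < t + ε := by
      refine lt_of_lt_of_le (hu j).2 ?_
      have : ε / ((j : ℝ) + 1) ≤ ε := div_le_self hε.le (by linarith [Nat.cast_nonneg (α := ℝ) j])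
      linarith
    rw [← hconst (u j) ⟨(hu j).1.le, h3⟩]
    exact hu2 j
  -- the integral equation
  have hII : ∀ a b, ∀ k, 0 ≤ a + s k → 0 ≤ b + s k →
      IntervalIntegrable (fun t => f (X (t + s k), σ (t + s k))) volume a b ∧
      X (b + s k) = X (a + s k) + ∫ t in a..b, f (X (t + s k), σ (t + s k)) := by
    intro a b k ha hb
    obtain ⟨h1, h2⟩ := hintg _ _ ha hb
    refine ⟨by simpa using h1.comp_add_right (s k), ?_⟩
    rw [h2, intervalIntegral.integral_comp_add_right (fun t => f (X t, σ t)) (s k)]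
  have hmeas : ∀ a b, ∀ᶠ k in atTop, AEStronglyMeasurable
      (fun t => f (X (t + s k), σ (t + s k))) (volume.restrict (Set.uIoc a b)) := by
    intro a b
    filter_upwards [hnn a, hnn b] with k h1 h2
    exact (hII a b k h1 h2).1.def'.aestronglyMeasurable
  have htr : ∀ a b, IntervalIntegrable (fun t => f (z t, σs t)) volume a b ∧
      z b = z a + ∫ t in a..b, f (z t, σs t) := by
    intro a b
    constructor
    · rw [intervalIntegrable_iff]
      have : IsFiniteMeasure (volume.restrict (Set.uIoc a b)) :=
        ⟨by simp [Set.uIoc]⟩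
      refine Integrable.of_bound (μ := volume.restrict (Set.uIoc a b)) ?_ L
        (ae_restrict_of_ae hfbd)
      obtain ⟨k₀, hk₀⟩ := eventually_atTop.1 (hmeas a b)
      refine aestronglyMeasurable_of_tendsto_ae (u := atTop)
        (f := fun k t => f (X (t + s (k + k₀)), σ (t + s (k + k₀))))
        (fun k => hk₀ (k + k₀) (Nat.le_add_left _ _)) ?_
      refine ae_restrict_of_ae ?_
      filter_upwards [hfconv] with t ht
      exact ht.comp (tendsto_add_atTop_nat k₀)
    · have h1 : Tendsto (fun k => ∫ t in a..b, f (X (t + s k), σ (t + s k))) atTop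
          (𝓝 (∫ t in a..b, f (z t, σs t))) := by
        refine intervalIntegral.tendsto_integral_filter_of_dominated_convergence (fun _ => L)
          (hmeas a b) ?_ intervalIntegrable_const ?_
        · filter_upwards [hnn a, hnn b] with k h1 h2
          refine Eventually.of_forall (fun t ht => hfL _ ?_)
          have : min a b < t := ht.1
          rcases min_lt_iff.1 this with h | h <;> linarith
        · filter_upwards [hfconv] with t ht _ using ht
      refine tendsto_nhds_unique (hzt b) ?_
      refine ((hzt a).add h1).congr' ?_
      filter_upwards [hnn a, hnn b] with k h1 h2
      exact (hII a b k h1 h2).2.symm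
  refine ⟨(z, σs), ⟨⟨hsig, univ_nonempty, ordConnected_univ, hzc.continuousOn,
    fun t _ => hmem_all t, fun a _ b _ => htr a b⟩, hσs⟩, ?_, ?_, ?_⟩
  · have := hzt 0
    simp only [zero_add] at this
    exact tendsto_nhds_unique this hsx'
  · skip
    obtain ⟨δ, hδ0, hδr⟩ := EReal.lt_iff_exists_real_btwn.1 hr
    have hδ : 0 < δ := EReal.coe_pos.1 hδ0
    obtain ⟨ε, hε, hconst⟩ := hsig.rightConst 0
    obtain ⟨u, hu, hu2⟩ := aux_ae_point hae (show (0 : ℝ) < min δ ε from lt_min hδ hε)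
    have h1 : σs u = σs 0 := hconst u ⟨hu.1.le, by
      rw [zero_add]; exact hu.2.trans_le (min_le_right _ _)⟩
    change σs 0 = γ
    rw [← h1]
    refine tendsto_nhds_unique hu2 (hsσ'.congr' ?_)
    filter_upwards [hrt'.eventually_const_lt hδr] with k hk
    refine (aux_const (hSsig σ hσ) (aux_tau_lt hk) ⟨by linarith [hu.1], ?_⟩).symm
    have := hu.2.trans_le (min_le_left δ ε)
    linarith
  · skip
    intro t
    obtain ⟨δ₀, h0, hgap⟩ := aux_gap_P hP (fun k t => σ (t + s k))
      (fun k => hP.2.1 σ hσ _ (hspos k)) t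
    refine aux_mem (δ := δ₀ / 2) (by linarith) (fun ε hε T => ?_)
    obtain ⟨η, hη, hconst⟩ := hsig.rightConst t
    obtain ⟨δ, hδ, hδ1⟩ := exists_between
      (show (0 : ℝ) < min (min (δ₀ / 2) η) (ε / (2 * (L + 1))) by
        refine lt_min (lt_min (by linarith) hη) (by positivity))
    rw [lt_min_iff, lt_min_iff] at hδ1
    obtain ⟨⟨hδ1, hδ2⟩, hδ3⟩ := hδ1
    have hLδ : L * δ ≤ ε / 2 := by
      calc L * δ ≤ (L + 1) * (ε / (2 * (L + 1))) :=
            mul_le_mul (by linarith) hδ3.le hδ.le (by linarith)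
        _ = ε / 2 := by field_simp
    obtain ⟨u, hu, hu2⟩ := aux_ae_point hae
      (show t + δ < min (t + δ₀) (t + η) from lt_min (by linarith) (by linarith))
    obtain ⟨hua, hub⟩ := lt_min_iff.1 hu.2
    have h1 : σs u = σs t := hconst u ⟨by linarith [hu.1], hub⟩
    rw [h1] at hu2
    have hE1 := (Metric.tendsto_nhds.1 hu2) ε hε
    have hE2 := (Metric.tendsto_nhds.1 (hzt t)) (ε / 2) (by linarith)
    have hE3 := hst.eventually_ge_atTop (T - t)
    obtain ⟨k, hk, hk1, hk2, hk3⟩ := ((hgap δ hδ (by linarith)).and_eventually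
      (hE1.and (hE2.and hE3))).exists
    refine ⟨t + δ + s k, by linarith, ?_, ?_, ?_⟩
    · intro v hv
      exact aux_contAt_shift hk v ⟨hv.1, by linarith [hv.2]⟩
    · have h2 := hL (t + δ + s k) (t + s k)
      have h3 : |t + δ + s k - (t + s k)| = δ := by
        rw [show t + δ + s k - (t + s k) = δ by ring, abs_of_pos hδ]
      rw [h3] at h2
      have h4 := dist_triangle (X (t + δ + s k)) (X (t + s k)) (z t)
      change dist (X (t + δ + s k)) (z t) < ε
      linarith
    · have h2 := aux_const (hSsig _ (hP.2.1 σ hσ _ (hspos k))) hk (s := u) ⟨hu.1.le, hua⟩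
      change dist (σ (t + δ + s k)) (σs t) < ε
      rw [← h2]
      exact hk1

noncomputable section
theorem omegaSharp_weaklyInvariant
    {n : ℕ} {Γ : Type*} [MetricSpace Γ] [CompactSpace Γ]
    (f : Eucl n × Γ → Eucl n) (domf : Set (Eucl n × Γ))
    (hdomf : IsClosed domf) (hf : ContinuousOn f domf)
    (Sstar : Set (ℝ → Γ)) (hP : HasPropertyP Sstar)
    (x : ℝ → Eucl n) (σ : ℝ → Γ) (Ix : Set ℝ)
    (htraj : IsTrajectory f domf x σ Ix) (hfc : Set.Ici (0 : ℝ) ⊆ Ix)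
    (hpre : PrecompactRel x Ix Set.univ) (hσ : σ ∈ Sstar) :
    WeaklyInvariant (TrajOf f domf Sstar) (OmegaSharp x σ) := by
  obtain ⟨B, -, hB, hxB⟩ := hpre
  obtain ⟨X, hXd⟩ : ∃ X : ℝ → Eucl n, X = fun t => x (max t 0) := ⟨_, rfl⟩
  have hXx : ∀ t, 0 ≤ t → X t = x t := by
    intro t ht
    rw [hXd]
    simp [ht]
  have hOm : OmegaSharp x σ = OmegaSharp X σ := by
    ext p
    constructor
    · rintro ⟨s, h1, h2, h3, h4, h5, h6⟩
      exact ⟨s, h1, h2, h3, h4, by simpa only [hXx _ (h2 _)] using h5, h6⟩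
    · rintro ⟨s, h1, h2, h3, h4, h5, h6⟩
      exact ⟨s, h1, h2, h3, h4, by simpa only [hXx _ (h2 _)] using h5, h6⟩
  have hX : ∀ t, X t ∈ B := by
    intro t
    rw [hXd]
    exact hxB _ (hfc (Set.mem_Ici.2 (le_max_right _ _)))
  have hmem : ∀ t, 0 ≤ t → (X t, σ t) ∈ domf := by
    intro t ht
    rw [hXx t ht]
    exact htraj.mem t (hfc ht)
  have hK : IsCompact ((B ×ˢ (univ : Set Γ)) ∩ domf) := (hB.prod isCompact_univ).inter_right hdomf
  obtain ⟨L, hLb⟩ := hK.exists_bound_of_continuousOn (hf.mono inter_subset_right)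
  have hfL : ∀ t, 0 ≤ t → ‖f (X t, σ t)‖ ≤ max L 0 := fun t ht =>
    (hLb _ ⟨⟨hX t, mem_univ _⟩, hmem t ht⟩).trans (le_max_left _ _)
  have hintg : ∀ a b, 0 ≤ a → 0 ≤ b →
      IntervalIntegrable (fun s => f (X s, σ s)) volume a b ∧
      X b = X a + ∫ s in a..b, f (X s, σ s) := by
    intro a b ha hb
    obtain ⟨h1, h2⟩ := htraj.intg a (hfc ha) b (hfc hb)
    have hEq : ∀ s ∈ Set.uIcc a b, f (x s, σ s) = f (X s, σ s) := by
      intro s hs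
      rw [hXx s ((le_min ha hb).trans hs.1)]
    refine ⟨h1.congr (fun s hs => hEq s (Set.uIoc_subset_uIcc hs)), ?_⟩
    rw [hXx b hb, hXx a ha, h2, intervalIntegral.integral_congr hEq]
  have hL1 : ∀ a b, 0 ≤ a → 0 ≤ b → dist (X a) (X b) ≤ max L 0 * |a - b| := by
    intro a b ha hb
    have h1 := (hintg b a hb ha).2
    rw [dist_eq_norm, h1, add_sub_cancel_left]
    refine intervalIntegral.norm_integral_le_of_norm_le_const (fun s hs => hfL s ?_)
    exact (le_min hb ha).trans hs.1.le
  have hL2 : ∀ a b, dist (X a) (X b) ≤ max L 0 * |a - b| := by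
    intro a b
    have h1 := hL1 (max a 0) (max b 0) (le_max_right _ _) (le_max_right _ _)
    have h2 : ∀ c, X (max c 0) = X c := by
      intro c
      rw [hXd]
      simp
    rw [h2, h2] at h1
    exact h1.trans (mul_le_mul_of_nonneg_left (abs_max_sub_max_le_abs a b 0) (le_max_right _ _))
  rw [hOm]
  exact ⟨aux_nonempty hP hσ hB hX, aux_core f domf hdomf hf Sstar hP X σ hσ hB hX
    (le_max_right _ _) hL2 hmem hfL hintg⟩
end
end

section
/- Let S* be a family of switching signals with property P and let T* be the set of all complete trajectories of the switched system ẋ = f(x,σ) whose switching signal lies in S*. Suppose (x,σ), with σ ∈ S*, is a forward complete trajectory, and suppose there exists a continuous function h : dom(h) → ℝ, with dom(h) ⊆ ℝⁿ × Γ, such that (x(t),σ(t)) evolves in a compact subset K of dom(h) for all t ≥ 0 and the function y(t) = h(x(t),σ(t)) is weakly meagre. Then x → π₁(M*), where M* is the maximal weakly invariant set w.r.t. T* contained in h⁻¹(0) ∩ dom(f). -/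
open Filter Topology MeasureTheory Set

theorem aux_freq {Q : ℝ → Prop} (hQ : ∀ᵐ t ∂(volume : Measure ℝ), Q t) (t : ℝ) :
    ∃ᶠ s in 𝓝[>] t, Q s := by
  intro hn
  rw [eventually_iff, mem_nhdsGT_iff_exists_Ioo_subset] at hn
  obtain ⟨u, hu, hsub⟩ := hn
  have h0 : volume (Ioo t u) = 0 := measure_mono_null hsub (ae_iff.mp hQ)
  rw [Real.volume_Ioo] at h0
  have := ENNReal.ofReal_eq_zero.mp h0
  simp only [mem_Ioi] at hu
  linarith

theorem aux_rc {Γ : Type*} [TopologicalSpace Γ] {σ : ℝ → Γ} (hs : IsSwitchingSignal σ) (t : ℝ) :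
    Tendsto σ (𝓝[>] t) (𝓝 (σ t)) := by
  obtain ⟨ε, he, h⟩ := hs.rightConst t
  refine tendsto_const_nhds.congr' ?_
  filter_upwards [Ioo_mem_nhdsGT (show t < t + ε by linarith)] with s hs'
  exact (h s ⟨hs'.1.le, hs'.2⟩).symm

theorem aux_closed {E Γ : Type*} [TopologicalSpace E] [TopologicalSpace Γ] {σ : ℝ → Γ}
    (hs : IsSwitchingSignal σ) {ξ : ℝ → E} (hξ : Continuous ξ) {C : Set (E × Γ)} (hC : IsClosed C)
    (hae : ∀ᵐ t ∂(volume : Measure ℝ), (ξ t, σ t) ∈ C) (t : ℝ) : (ξ t, σ t) ∈ C := by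
  have h1 : Tendsto (fun s => (ξ s, σ s)) (𝓝[>] t) (𝓝 (ξ t, σ t)) :=
    (hξ.continuousAt.tendsto.mono_left nhdsWithin_le_nhds).prodMk_nhds (aux_rc hs t)
  exact hC.mem_of_frequently_of_tendsto (aux_freq hae t) h1

theorem aux_sigeq {Γ : Type*} [TopologicalSpace Γ] [T2Space Γ] {σ σ' : ℝ → Γ}
    (hs : IsSwitchingSignal σ) (hs' : IsSwitchingSignal σ')
    (hae : ∀ᵐ t ∂(volume : Measure ℝ), σ t = σ' t) : σ = σ' := by
  funext t
  have h1 : Tendsto (fun s => (σ s, σ' s)) (𝓝[>] t) (𝓝 (σ t, σ' t)) :=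
    (aux_rc hs t).prodMk_nhds (aux_rc hs' t)
  exact isClosed_diagonal.mem_of_frequently_of_tendsto (s := diagonal Γ)
    (by simpa using aux_freq hae t) h1

theorem aux_const_s7 {Γ : Type*} [TopologicalSpace Γ] [T2Space Γ] {σ : ℝ → Γ}
    (hs : IsSwitchingSignal σ) {a b : ℝ} (hJ : ∀ t ∈ Ioo a b, t ∉ JumpTimes σ) :
    ∀ s ∈ Ioo a b, ∀ t ∈ Ioo a b, σ s = σ t := by
  have key : ∀ t ∈ Ioo a b, ∀ᶠ s in 𝓝 t, σ t = σ s := by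
    intro t ht
    have hc : ContinuousAt σ t := by simpa [JumpTimes] using hJ t ht
    obtain ⟨ε, he, h⟩ := hs.rightConst t
    obtain ⟨ε', he', h'⟩ := hs.leftConst t
    have hl : ∀ s ∈ Ioo (t - ε') t, σ t = σ s := by
      intro s hs1
      have h2 : Tendsto σ (𝓝[<] t) (𝓝 (σ t)) := hc.tendsto.mono_left nhdsWithin_le_nhds
      have h3 : Tendsto σ (𝓝[<] t) (𝓝 (σ s)) := by
        refine tendsto_const_nhds.congr' ?_
        filter_upwards [Ioo_mem_nhdsLT (show t - ε' < t by linarith)] with r hr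
        exact h' s hs1 r hr
      exact tendsto_nhds_unique h2 h3
    filter_upwards [Ioo_mem_nhds (show t - ε' < t by linarith) (show t < t + ε by linarith)]
      with s hs1
    rcases lt_or_ge s t with hlt | hge
    · exact hl s ⟨hs1.1, hlt⟩
    · exact (h s ⟨hge, hs1.2⟩).symm
  intro s hs1 t ht1
  exact isPreconnected_Ioo.induction₂ (fun u v => σ u = σ v)
    (fun u hu => nhdsWithin_le_nhds (key u hu)) (fun _ _ _ _ _ _ h1 h2 => h1.trans h2)
    (fun _ _ _ _ h => h.symm) hs1 ht1

/-- Pigeonhole: a signal with at most `N` jumps on `(a, a + (N+1) w)` has no jump on one of the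
`N + 1` subintervals of length `w`. -/
theorem aux_pigeon {J : Set ℝ} {a w : ℝ} {N : ℕ} (hw : 0 < w)
    (hfin : (J ∩ Ioo a (a + (N + 1) * w)).Finite)
    (hcard : (J ∩ Ioo a (a + (N + 1) * w)).ncard ≤ N) :
    ∃ i : ℕ, i ≤ N ∧ ∀ t ∈ Ioo (a + i * w) (a + (i + 1) * w), t ∉ J := by
  by_contra hcon
  push Not at hcon
  choose! g hg hgJ using hcon
  have hsub : g '' (Finset.range (N + 1) : Set ℕ) ⊆ J ∩ Ioo a (a + (N + 1) * w) := by
    rintro _ ⟨i, hi, rfl⟩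
    have hi' : i ≤ N := by simpa [Nat.lt_succ_iff] using hi
    have hiR : (i : ℝ) ≤ N := by exact_mod_cast hi'
    have h1 := hg i hi'
    refine ⟨hgJ i hi', ?_, ?_⟩
    · have : 0 ≤ (i : ℝ) * w := by positivity
      linarith [h1.1]
    · have : ((i : ℝ) + 1) * w ≤ (N + 1) * w := by gcongr
      linarith [h1.2]
  have hinj : InjOn g (Finset.range (N + 1) : Set ℕ) := by
    have main : ∀ i j, i ≤ N → j ≤ N → i < j → g i < g j := by
      intro i j hi hj hij
      have h1 := (hg i hi).2
      have h2 := (hg j hj).1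
      have hijR : (i : ℝ) + 1 ≤ j := by exact_mod_cast hij
      have : ((i : ℝ) + 1) * w ≤ j * w := by gcongr
      linarith
    intro i hi j hj hij
    have hi' : i ≤ N := by simpa [Nat.lt_succ_iff] using hi
    have hj' : j ≤ N := by simpa [Nat.lt_succ_iff] using hj
    rcases lt_trichotomy i j with hlt | heq | hgt
    · exact absurd hij (main i j hi' hj' hlt).ne
    · exact heq
    · exact absurd hij (main j i hj' hi' hgt).ne'
  have h1 := ncard_le_ncard hsub hfin
  rw [hinj.ncard_image, ncard_coe_finset, Finset.card_range] at h1
  omega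

/-- Sequential compactness of uniformly Lipschitz families, with pointwise convergence. -/
theorem aux_ascoli {E : Type*} [NormedAddCommGroup E] [CompleteSpace E] {L : NNReal} {B : Set E}
    (hB : IsCompact B) (z : ℕ → ℝ → E) (hz : ∀ k, LipschitzWith L (z k)) (hzB : ∀ k t, z k t ∈ B) :
    ∃ φ : ℕ → ℕ, StrictMono φ ∧ ∃ ξ : ℝ → E, LipschitzWith L ξ ∧
      ∀ t, Tendsto (fun k => z (φ k) t) atTop (𝓝 (ξ t)) := by
  have hc : IsCompact (Set.pi univ (fun _ : ℚ => B)) := isCompact_univ_pi fun _ => hB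
  obtain ⟨ζ, -, φ, hφ, hlim⟩ := hc.tendsto_subseq (x := fun k (q : ℚ) => z k q)
    (fun k q _ => hzB k q)
  rw [tendsto_pi_nhds] at hlim
  have hcau : ∀ t, ∃ e, Tendsto (fun k => z (φ k) t) atTop (𝓝 e) := by
    intro t
    apply cauchySeq_tendsto_of_complete
    rw [Metric.cauchySeq_iff']
    intro ε he
    obtain ⟨q, hq1, hq2⟩ := exists_rat_btwn (show t < t + ε / (4 * (L + 1)) by
      have : 0 < ε / (4 * ((L : ℝ) + 1)) := by positivity
      linarith)
    have hd : ∀ k, dist (z k t) (z k q) ≤ ε / 4 := by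
      intro k
      refine ((hz k).dist_le_mul _ _).trans ?_
      have hL := L.coe_nonneg
      have h1 : dist t (q : ℝ) ≤ ε / (4 * (L + 1)) := by
        rw [Real.dist_eq, abs_le]; constructor <;> linarith
      calc (L : ℝ) * dist t q ≤ (L + 1) * (ε / (4 * (L + 1))) := by gcongr; linarith
        _ = ε / 4 := by field_simp
    obtain ⟨N, hN⟩ := Metric.cauchySeq_iff'.mp (hlim q).cauchySeq (ε / 4) (by positivity)
    refine ⟨N, fun k hk => ?_⟩
    have h1 := hN k hk
    simp only [Function.comp] at h1
    have h2 := hd (φ k)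
    have h3 := hd (φ N)
    have h4 := dist_triangle4 (z (φ k) t) (z (φ k) q) (z (φ N) q) (z (φ N) t)
    rw [dist_comm (z (φ N) q)] at h4
    linarith
  choose ξ hξ using hcau
  refine ⟨φ, hφ, ξ, ?_, hξ⟩
  refine LipschitzWith.of_dist_le_mul fun s t => ?_
  exact le_of_tendsto ((hξ s).dist (hξ t)) (Eventually.of_forall fun k => (hz (φ k)).dist_le_mul s t)

theorem aux_pair {E Γ : Type*} [TopologicalSpace E] [TopologicalSpace Γ]
    {x : ℝ → E} {σ : ℝ → Γ} {T : ℕ → ℝ} {ξ : ℝ → E} {η : ℝ → Γ} 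
    (hx : ∀ t, Tendsto (fun k => x (max (t + T k) 0)) atTop (𝓝 (ξ t)))
    (hT : Tendsto T atTop atTop) {t : ℝ}
    (hσ : Tendsto (fun k => σ (t + T k)) atTop (𝓝 (η t))) :
    Tendsto (fun k => (x (t + T k), σ (t + T k))) atTop (𝓝 (ξ t, η t)) := by
  refine Tendsto.prodMk_nhds ((hx t).congr' ?_) hσ
  filter_upwards [hT.eventually_ge_atTop (-t)] with k hk
  rw [max_eq_left (by linarith)]

theorem aux_mem_s7 {E Γ : Type*} [TopologicalSpace E] [TopologicalSpace Γ]
    {x : ℝ → E} {σ : ℝ → Γ} {T : ℕ → ℝ} {ξ : ℝ → E} {η : ℝ → Γ} {C : Set (E × Γ)} (hC : IsClosed C)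
    (hev : ∀ t : ℝ, 0 ≤ t → (x t, σ t) ∈ C) (hη : IsSwitchingSignal η)
    (hx : ∀ t, Tendsto (fun k => x (max (t + T k) 0)) atTop (𝓝 (ξ t))) (hξ : Continuous ξ)
    (hT : Tendsto T atTop atTop)
    (hσ : ∀ᵐ t ∂(volume : Measure ℝ), Tendsto (fun k => σ (t + T k)) atTop (𝓝 (η t))) (t : ℝ) :
    (ξ t, η t) ∈ C := by
  refine aux_closed hη hξ hC ?_ t
  filter_upwards [hσ] with s hs
  refine hC.mem_of_tendsto (aux_pair hx hT hs) ?_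
  filter_upwards [hT.eventually_ge_atTop (-s)] with k hk
  exact hev _ (by linarith)

theorem aux_traj {n : ℕ} {Γ : Type*} [MetricSpace Γ]
    {f : Eucl n × Γ → Eucl n} {domf : Set (Eucl n × Γ)} (hf : ContinuousOn f domf)
    {x : ℝ → Eucl n} {σ : ℝ → Γ} {Ix : Set ℝ}
    (htraj : IsTrajectory f domf x σ Ix) (hfc : Set.Ici (0 : ℝ) ⊆ Ix)
    {T : ℕ → ℝ} {ξ : ℝ → Eucl n} {η : ℝ → Γ} {C : Set (Eucl n × Γ)} (hC : IsClosed C)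
    (hCsub : C ⊆ domf) {L : ℝ} (hL : ∀ p ∈ C, ‖f p‖ ≤ L)
    (hev : ∀ t : ℝ, 0 ≤ t → (x t, σ t) ∈ C) (hη : IsSwitchingSignal η)
    (hx : ∀ t, Tendsto (fun k => x (max (t + T k) 0)) atTop (𝓝 (ξ t))) (hξ : Continuous ξ)
    (hT : Tendsto T atTop atTop)
    (hσ : ∀ᵐ t ∂(volume : Measure ℝ), Tendsto (fun k => σ (t + T k)) atTop (𝓝 (η t))) :
    IsTrajectory f domf ξ η univ := by
  have hmem := aux_mem_s7 hC hev hη hx hξ hT hσ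
  refine ⟨hη, univ_nonempty, ordConnected_univ, hξ.continuousOn, fun t _ => hCsub (hmem t), ?_⟩
  intro t₀ _ t _
  -- the shifted velocities
  set F : ℕ → ℝ → Eucl n := fun k s => f (x (s + T k), σ (s + T k)) with hF
  have hev' : ∀ᶠ k in atTop, 0 ≤ t₀ + T k ∧ 0 ≤ t + T k := by
    filter_upwards [hT.eventually_ge_atTop (-t₀), hT.eventually_ge_atTop (-t)] with k h1 h2
    constructor <;> linarith
  have hpos : ∀ k, 0 ≤ t₀ + T k ∧ 0 ≤ t + T k → ∀ s ∈ uIoc t₀ t, 0 ≤ s + T k := by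
    intro k hk s hs
    rcases mem_uIoc.mp hs with h1 | h1 <;> linarith [h1.1, hk.1, hk.2]
  have hint : ∀ᶠ k in atTop, IntervalIntegrable (F k) volume t₀ t := by
    filter_upwards [hev'] with k hk
    have h1 := (htraj.intg (t₀ + T k) (hfc hk.1) (t + T k) (hfc hk.2)).1
    have h2 := h1.comp_add_right (T k)
    simpa [hF] using h2
  have hae : ∀ᵐ s ∂(volume : Measure ℝ), Tendsto (fun k => F k s) atTop (𝓝 (f (ξ s, η s))) := by
    filter_upwards [hσ] with s hs
    have h1 := aux_pair hx hT hs
    have h2 : Tendsto (fun k => (x (s + T k), σ (s + T k))) atTop (𝓝[domf] (ξ s, η s)) := by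
      refine tendsto_nhdsWithin_iff.mpr ⟨h1, ?_⟩
      filter_upwards [hT.eventually_ge_atTop (-s)] with k hk
      exact hCsub (hev _ (by linarith))
    exact (hf _ (hCsub (hmem s))).tendsto.comp h2
  have hmeas : AEStronglyMeasurable (fun s => f (ξ s, η s)) (volume.restrict (uIoc t₀ t)) := by
    obtain ⟨k0, hk0⟩ := eventually_atTop.mp hint
    refine aestronglyMeasurable_of_tendsto_ae (u := atTop) (f := fun k => F (k + k0)) 
      (fun k => (hk0 (k + k0) (by omega)).def'.aestronglyMeasurable) ?_
    filter_upwards [ae_restrict_of_ae hae] with s hs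
    exact (tendsto_add_atTop_iff_nat k0).mpr hs
  have hlim : Tendsto (fun k => ∫ s in t₀..t, F k s) atTop (𝓝 (∫ s in t₀..t, f (ξ s, η s))) := by
    refine intervalIntegral.tendsto_integral_filter_of_dominated_convergence (fun _ => L) 
      ?_ ?_ intervalIntegrable_const ?_
    · filter_upwards [hint] with k hk using hk.def'.aestronglyMeasurable
    · filter_upwards [hev'] with k hk
      exact Eventually.of_forall fun s hs => hL _ (hev _ (hpos k hk s hs))
    · filter_upwards [hae] with s hs _ using hs
  constructor
  · rw [intervalIntegrable_iff]
    have hfm : IsFiniteMeasure (volume.restrict (uIoc t₀ t)) := ⟨by simp⟩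
    exact Integrable.of_bound hmeas L (Eventually.of_forall fun s => hL _ (hmem s))
  · refine tendsto_nhds_unique (hx t) (((hx t₀).add hlim).congr' ?_)
    filter_upwards [hev'] with k hk
    rw [max_eq_left hk.1, max_eq_left hk.2, 
      (htraj.intg (t₀ + T k) (hfc hk.1) (t + T k) (hfc hk.2)).2]
    simp only [hF]
    rw [intervalIntegral.integral_comp_add_right (fun s => f (x s, σ s))]

theorem aux_lip {n : ℕ} {Γ : Type*} [TopologicalSpace Γ]
    {f : Eucl n × Γ → Eucl n} {domf : Set (Eucl n × Γ)}
    {x : ℝ → Eucl n} {σ : ℝ → Γ} {Ix : Set ℝ}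
    (htraj : IsTrajectory f domf x σ Ix) (hfc : Set.Ici (0 : ℝ) ⊆ Ix)
    {L : NNReal} (hL : ∀ t : ℝ, 0 ≤ t → ‖f (x t, σ t)‖ ≤ L) (a : ℝ) :
    LipschitzWith L (fun t => x (max (t + a) 0)) := by
  refine LipschitzWith.of_dist_le_mul fun s t => ?_
  have h1 := (htraj.intg (max (t + a) 0) (hfc (mem_Ici.mpr (le_max_right _ _))) (max (s + a) 0)
    (hfc (mem_Ici.mpr (le_max_right _ _)))).2
  rw [dist_eq_norm, h1, add_sub_cancel_left]
  refine (intervalIntegral.norm_integral_le_of_norm_le_const (C := L) ?_).trans ?_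
  · intro r hr
    apply hL
    have h2 := le_max_right (t + a) 0
    have h3 := le_max_right (s + a) 0
    rcases mem_uIoc.mp hr with h4 | h4 <;> linarith [h4.1]
  · gcongr
    refine (abs_max_sub_max_le_abs _ _ _).trans ?_
    rw [Real.dist_eq]; simp

/-- Negative shifts of limit signals belong to the family too. -/
theorem aux_shift {Γ : Type*} [MetricSpace Γ] {S : Set (ℝ → Γ)} (hP : HasPropertyP S)
    {σ η : ℝ → Γ} (hσS : σ ∈ S) (hη : η ∈ S) {T : ℕ → ℝ} (hT : Tendsto T atTop atTop)
    (hσ : ∀ᵐ t ∂(volume : Measure ℝ), Tendsto (fun k => σ (t + T k)) atTop (𝓝 (η t))) (s : ℝ) :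
    (fun t => η (t + s)) ∈ S := by
  obtain ⟨⟨τD, hτ, N₀, hsub⟩, hsh, hcpt⟩ := hP
  obtain ⟨k0, hk0⟩ := eventually_atTop.mp (hT.eventually_gt_atTop (-s))
  obtain ⟨σ', hσ', φ, hφ, hlim⟩ := hcpt (fun k t => σ (t + (s + T (k + k0))))
    (fun k => hsh σ hσS _ (by linarith [hk0 (k + k0) (by omega)]))
  have hsw : IsSwitchingSignal (fun t => η (t + s)) := by
    have h := (hsub hη).1
    have hJ : JumpTimes (fun t => η (t + s)) = (fun t => t + s) ⁻¹' JumpTimes η := by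
      ext t
      simp only [JumpTimes, mem_ofPred_eq, mem_preimage, not_iff_not]
      constructor
      · intro hc
        have h1 : ContinuousAt (fun t => η (t + s)) ((t + s) + (-s)) := by simpa using hc
        have h2 := ContinuousAt.comp (f := fun u : ℝ => u + (-s)) (x := t + s) h1 (by fun_prop)
        have h3 : ((fun t => η (t + s)) ∘ fun u : ℝ => u + (-s)) = η := by
          funext u; simp
        rwa [h3] at h2
      · intro hc
        exact ContinuousAt.comp (f := fun u : ℝ => u + s) (x := t) hc (by fun_prop)
    refine ⟨fun a b => ?_, fun t => ?_, fun t => ?_⟩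
    · rw [hJ]
      refine ((h.locFinite (a + s) (b + s)).preimage (f := fun t => t + s)
        (add_left_injective s).injOn).subset ?_
      rintro u ⟨hu1, hu2, hu3⟩
      exact ⟨hu1, by simpa using hu2, by simpa using hu3⟩
    · obtain ⟨ε, he, h1⟩ := h.rightConst (t + s)
      exact ⟨ε, he, fun u hu => h1 _ ⟨by linarith [hu.1], by linarith [hu.2]⟩⟩
    · obtain ⟨ε, he, h1⟩ := h.leftConst (t + s)
      exact ⟨ε, he, fun u hu v hv => h1 _ ⟨by linarith [hu.1], by linarith [hu.2]⟩ _
        ⟨by linarith [hv.1], by linarith [hv.2]⟩⟩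
  have heq : (fun t => η (t + s)) = σ' := by
    refine aux_sigeq hsw (hsub hσ').1 ?_
    have h1 := (measurePreserving_add_right (volume : Measure ℝ) s).quasiMeasurePreserving.ae hσ
    filter_upwards [h1, hlim] with t ht1 ht2
    refine tendsto_nhds_unique (f := fun l => σ (t + (s + T (φ l + k0)))) ?_ ht2
    have h2 : Tendsto (fun l => φ l + k0) atTop atTop :=
      (tendsto_add_atTop_nat k0).comp hφ.tendsto_atTop
    have h3 := ht1.comp h2
    refine h3.congr fun l => ?_
    simp [add_assoc]
  rw [heq]; exact hσ'

theorem aux_zero {n : ℕ} {Γ : Type*} [MetricSpace Γ]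
    {x : ℝ → Eucl n} {σ : ℝ → Γ} {T : ℕ → ℝ} {ξ : ℝ → Eucl n} {η : ℝ → Γ}
    {C : Set (Eucl n × Γ)} (hC : IsCompact C) {h : Eucl n × Γ → ℝ} (hh : ContinuousOn h C)
    (hev : ∀ t : ℝ, 0 ≤ t → (x t, σ t) ∈ C) {L : NNReal}
    (hlip : LipschitzWith L (fun t => x (max t 0))) (hη : IsSwitchingSignal η)
    {τD : ℝ} {N₀ : ℕ} (hτ : 0 < τD) (hSA : σ ∈ SA Γ τD N₀)
    (hwm : WeaklyMeagre fun t => h (x t, σ t))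
    (hx : ∀ t, Tendsto (fun k => x (max (t + T k) 0)) atTop (𝓝 (ξ t))) (hξ : Continuous ξ)
    (hT : Tendsto T atTop atTop) (hsp : ∀ k l, k < l → T k + 1 ≤ T l)
    (hσ : ∀ᵐ t ∂(volume : Measure ℝ), Tendsto (fun k => σ (t + T k)) atTop (𝓝 (η t))) (t₀ : ℝ) :
    h (ξ t₀, η t₀) = 0 := by
  by_contra hne
  have hmem := aux_mem_s7 hC.isClosed hev hη hx hξ hT hσ
  obtain ⟨c, hc, hc2⟩ : ∃ c > 0, 2 * c < |h (ξ t₀, η t₀)| :=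
    ⟨|h (ξ t₀, η t₀)| / 3, by positivity, by linarith [abs_pos.mpr hne]⟩
  obtain ⟨ε, he, huc⟩ := Metric.uniformContinuousOn_iff.mp
    (hC.uniformContinuousOn_of_continuous hh) c hc
  have hright : ∀ᶠ s in 𝓝[>] t₀, 2 * c < |h (ξ s, η s)| := by
    have h1 : Tendsto (fun s => (ξ s, η s)) (𝓝[>] t₀) (𝓝[C] (ξ t₀, η t₀)) := by
      refine tendsto_nhdsWithin_iff.mpr ⟨?_, Eventually.of_forall hmem⟩
      exact (hξ.continuousAt.tendsto.mono_left nhdsWithin_le_nhds).prodMk_nhds (aux_rc hη t₀)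
    have h2 := ((hh _ (hmem t₀)).tendsto.comp h1).abs
    exact h2.eventually_const_lt hc2
  rw [eventually_iff, mem_nhdsGT_iff_exists_Ioo_subset] at hright
  obtain ⟨u, hu, hus⟩ := hright
  simp only [mem_Ioi] at hu
  obtain ⟨δ, hδ, hδu, hδ1, hδε⟩ : ∃ δ > 0, δ ≤ u - t₀ ∧ δ ≤ 1 ∧ L * δ < ε := by
    refine ⟨min (min (u - t₀) 1) (ε / (L + 1)), ?_, ?_, ?_, ?_⟩
    · have : 0 < u - t₀ := by linarith
      positivity
    · exact (min_le_left _ _).trans (min_le_left _ _)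
    · exact (min_le_left _ _).trans (min_le_right _ _)
    · have hL := L.coe_nonneg
      have h1 : min (min (u - t₀) 1) (ε / (L + 1)) ≤ ε / ((L : ℝ) + 1) := min_le_right _ _
      calc (L : ℝ) * min (min (u - t₀) 1) (ε / (L + 1)) ≤ L * (ε / ((L : ℝ) + 1)) := by gcongr
        _ < (L + 1) * (ε / ((L : ℝ) + 1)) := by gcongr; linarith
        _ = ε := by field_simp
  obtain ⟨N, hN⟩ : ∃ N : ℕ, N₀ + 1 / τD ≤ N := exists_nat_ge _
  obtain ⟨w, hw, hwδ⟩ : ∃ w > 0, ((N : ℝ) + 1) * w = δ :=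
    ⟨δ / (N + 1), by positivity, by field_simp⟩
  have hsub : ∀ i : ℕ, i ≤ N → 0 ≤ (i : ℝ) * w ∧ ((i : ℝ) + 1) * w ≤ δ ∧
      ((i : ℝ) + 1) * w = i * w + w := by
    intro i hi
    have hiR : (i : ℝ) ≤ N := by exact_mod_cast hi
    refine ⟨by positivity, ?_, by ring⟩
    rw [← hwδ]; gcongr
  -- sampling points
  have hsamp : ∀ i : ℕ, ∃ s ∈ Ioo (t₀ + i * w) (t₀ + (i + 1) * w),
      Tendsto (fun k => σ (s + T k)) atTop (𝓝 (η s)) := by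
    intro i
    have h1 := aux_freq hσ (t₀ + i * w)
    have h2 : ∀ᶠ s in 𝓝[>] (t₀ + i * w), s ∈ Ioo (t₀ + i * w) (t₀ + (i + 1) * w) :=
      Ioo_mem_nhdsGT (by linarith [show ((i : ℝ) + 1) * w = i * w + w by ring])
    obtain ⟨s, hs1, hs2⟩ := (h1.and_eventually h2).exists
    exact ⟨s, hs2, hs1⟩
  choose s hs hslim using hsamp
  have hbig : ∀ᶠ k in atTop, ∀ i ∈ Finset.range (N + 1),
      2 * c < |h (x (s i + T k), σ (s i + T k))| := by
    rw [Filter.eventually_all_finset]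
    intro i hi
    have hi' : i ≤ N := by simpa [Nat.lt_succ_iff] using hi
    have h1 : Tendsto (fun k => (x (s i + T k), σ (s i + T k))) atTop (𝓝[C] (ξ (s i), η (s i))) := by
      refine tendsto_nhdsWithin_iff.mpr ⟨aux_pair hx hT (hslim i), ?_⟩
      filter_upwards [hT.eventually_ge_atTop (-(s i))] with k hk
      exact hev _ (by linarith)
    have h2 := ((hh _ (hmem (s i))).tendsto.comp h1).abs
    refine h2.eventually_const_lt (hus ⟨?_, ?_⟩)
    · linarith [(hs i).1, (hsub i hi').1]
    · linarith [(hs i).2, (hsub i hi').2.1]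
  have hev2 := hbig.and (hT.eventually_ge_atTop (-t₀))
  obtain ⟨k0, hk0⟩ := eventually_atTop.mp hev2
  -- the jump-free subintervals
  have hgood : ∀ k, ∃ i : ℕ, i ≤ N ∧ ∀ r ∈ Ioo (t₀ + T (k + k0) + i * w)
      (t₀ + T (k + k0) + (i + 1) * w), c ≤ |h (x r, σ r)| := by
    intro k
    obtain ⟨hb, hpos⟩ := hk0 (k + k0) (by omega)
    have hcard := hSA.2 (t₀ + T (k + k0)) (t₀ + T (k + k0) + (N + 1) * w) (by rw [hwδ]; linarith)
    obtain ⟨i, hi, hfree⟩ := aux_pigeon (J := JumpTimes σ) (a := t₀ + T (k + k0)) (N := N) hw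
      ((hSA.1.locFinite _ _).subset (inter_subset_inter_right _ Ioo_subset_Icc_self)) (by
        have h1 : (t₀ + T (k + k0) + (N + 1) * w - (t₀ + T (k + k0))) / τD ≤ 1 / τD := by
          rw [hwδ]; gcongr; linarith
        have h2 := (hcard.trans (add_le_add_right h1 _)).trans hN
        exact_mod_cast h2)
    refine ⟨i, hi, fun r hr => ?_⟩
    have hsb := hsub i hi
    have hsi : s i + T (k + k0) ∈ Ioo (t₀ + T (k + k0) + i * w)
      (t₀ + T (k + k0) + (i + 1) * w) := ⟨by linarith [(hs i).1], by linarith [(hs i).2]⟩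
    have hσeq := aux_const_s7 hSA.1 hfree r hr _ hsi
    have hr0 : 0 ≤ r := by linarith [hr.1]
    have hs0 : 0 ≤ s i + T (k + k0) := by linarith [hsi.1]
    have hxd : dist (x r) (x (s i + T (k + k0))) < ε := by
      have h1 := hlip.dist_le_mul r (s i + T (k + k0))
      simp only [max_eq_left hr0, max_eq_left hs0] at h1
      have h2 : dist r (s i + T (k + k0)) ≤ δ := by
        rw [Real.dist_eq, abs_le]
        constructor <;> linarith [hr.1, hr.2, hsi.1, hsi.2]
      have h3 : (L : ℝ) * dist r (s i + T (k + k0)) ≤ L * δ := by gcongr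
      linarith
    have h4 := huc _ (hev r hr0) _ (hev _ hs0) (by
      rw [Prod.dist_eq]
      simp only [hσeq, dist_self]
      exact max_lt hxd he)
    have h5 := hb i (by simpa [Nat.lt_succ_iff] using hi)
    rw [Real.dist_eq] at h4
    have h6 := abs_sub_abs_le_abs_sub (h (x (s i + T (k + k0)), σ (s i + T (k + k0)))) (h (x r, σ r))
    rw [abs_sub_comm] at h6
    linarith
  choose i hi hgd using hgood
  have hneI : ∀ k, (Ioo (t₀ + T (k + k0) + i k * w) (t₀ + T (k + k0) + (i k + 1) * w)).Nonempty := by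
    intro k
    exact nonempty_Ioo.mpr (by linarith [(hsub _ (hi k)).2.2])
  have hlim := hwm (fun k => Ioo (t₀ + T (k + k0) + i k * w) (t₀ + T (k + k0) + (i k + 1) * w))
    hneI ?_ (fun k => ordConnected_Ioo) ?_ ⟨ENNReal.ofReal w, by simpa using hw, fun k => ?_⟩
  · have hge : c ≤ 0 := by
      refine ge_of_tendsto hlim (Eventually.of_forall fun k => ?_)
      refine le_csInf ((hneI k).image _) ?_
      rintro _ ⟨r, hr, rfl⟩
      exact hgd k r hr
    linarith
  · intro k r hr
    have h1 := (hk0 (k + k0) (by omega)).2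
    rw [mem_Ici]
    linarith [hr.1, (hsub _ (hi k)).1]
  · have main : ∀ k l, k < l → Disjoint
        (Ioo (t₀ + T (k + k0) + i k * w) (t₀ + T (k + k0) + (i k + 1) * w))
        (Ioo (t₀ + T (l + k0) + i l * w) (t₀ + T (l + k0) + (i l + 1) * w)) := by
      intro k l hkl
      rw [Set.disjoint_left]
      intro r hr1 hr2
      have h1 := hsp (k + k0) (l + k0) (by omega)
      linarith [hr1.2, hr2.1, (hsub _ (hi k)).2.1, (hsub _ (hi l)).1]
    intro k l hkl
    rcases lt_or_gt_of_ne hkl with h1 | h1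
    · exact main k l h1
    · exact (main l k h1).symm
  · rw [Real.volume_Ioo]
    refine ENNReal.ofReal_le_ofReal ?_
    linarith [(hsub _ (hi k)).2.2]

noncomputable section
theorem invariance_principle_weakly_meagre
    {n : ℕ} {Γ : Type*} [MetricSpace Γ] [CompactSpace Γ]
    (f : Eucl n × Γ → Eucl n) (domf : Set (Eucl n × Γ))
    (hdomf : IsClosed domf) (hf : ContinuousOn f domf)
    (Sstar : Set (ℝ → Γ)) (hP : HasPropertyP Sstar)
    (x : ℝ → Eucl n) (σ : ℝ → Γ) (Ix : Set ℝ)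
    (htraj : IsTrajectory f domf x σ Ix) (hfc : Set.Ici (0 : ℝ) ⊆ Ix)
    (hσ : σ ∈ Sstar)
    (h : Eucl n × Γ → ℝ) (domh : Set (Eucl n × Γ)) (hconth : ContinuousOn h domh)
    (K : Set (Eucl n × Γ)) (hK : IsCompact K) (hKsub : K ⊆ domh)
    (hevol : ∀ t : ℝ, 0 ≤ t → (x t, σ t) ∈ K)
    (hwm : WeaklyMeagre fun t => h (x t, σ t)) :
    ConvergesTo x (Prod.fst ''
      MaxWeaklyInvariantIn (TrajOf f domf Sstar)
        ({p : Eucl n × Γ | h p = 0} ∩ domf)) := by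
  by_contra hcon
  obtain ⟨τD, hτ, N₀, hSsub⟩ := hP.1
  have hPsh := hP.2.1
  have hPc := hP.2.2
  set P : Set (Eucl n) := Prod.fst '' MaxWeaklyInvariantIn (TrajOf f domf Sstar)
        ({p : Eucl n × Γ | h p = 0} ∩ domf) with hPdef
  -- a bad sequence of times
  have hbad : ∃ ε > 0, ∀ a : ℝ, ∃ t ≥ a, ε ≤ Metric.infDist (x t) P := by
    by_contra hno
    push Not at hno
    apply hcon
    rw [ConvergesTo, Metric.tendsto_atTop]
    intro ε he
    obtain ⟨a, ha⟩ := hno ε he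
    refine ⟨a, fun t ht => ?_⟩
    rw [Real.dist_eq, sub_zero, abs_of_nonneg Metric.infDist_nonneg]
    exact ha t ht
  obtain ⟨ε, he, hbad⟩ := hbad
  choose g hg1 hg2 using hbad
  set T : ℕ → ℝ := fun k => Nat.rec (g 1) (fun _ r => g (r + 1)) k with hTdef
  have hTs : ∀ k, T k + 1 ≤ T (k + 1) := fun k => hg1 _
  have hTbad : ∀ k, ε ≤ Metric.infDist (x (T k)) P := by
    intro k
    cases k with
    | zero => exact hg2 _
    | succ k => exact hg2 _
  have hTge : ∀ k : ℕ, (k : ℝ) + 1 ≤ T k := by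
    intro k
    induction k with
    | zero =>
      have h1 : (1 : ℝ) ≤ T 0 := hg1 1
      simpa using h1
    | succ k ih => push_cast; linarith [hTs k]
  have hTsp : ∀ k l, k < l → T k + 1 ≤ T l := by
    intro k l hkl
    induction l, hkl using Nat.le_induction with
    | base => exact hTs k
    | succ l _ ih => linarith [hTs l]
  have hTtop : Tendsto T atTop atTop :=
    tendsto_atTop_mono (fun k => by linarith [hTge k]) tendsto_natCast_atTop_atTop
  -- compactness
  have hC : IsCompact (K ∩ domf) := hK.inter_right hdomf
  have hev : ∀ t : ℝ, 0 ≤ t → (x t, σ t) ∈ K ∩ domf :=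
    fun t ht => ⟨hevol t ht, htraj.mem t (hfc ht)⟩
  obtain ⟨L0, hL0⟩ := hC.exists_bound_of_continuousOn (hf.mono inter_subset_right)
  have hL : ∀ p ∈ K ∩ domf, ‖f p‖ ≤ (L0.toNNReal : ℝ) :=
    fun p hp => (hL0 p hp).trans (Real.le_coe_toNNReal L0)
  have hlip := fun a => aux_lip htraj hfc (L := L0.toNNReal) (fun t ht => hL _ (hev t ht)) a
  obtain ⟨η, hη, φ, hφ, hσlim⟩ := hPc (fun k t => σ (t + T k))
    (fun k => hPsh σ hσ (T k) (by linarith [hTge k, Nat.cast_nonneg (α := ℝ) k]))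
  obtain ⟨ψ, hψ, ξ, hξ, hxlim⟩ := aux_ascoli (hK.image continuous_fst)
    (fun k t => x (max (t + T (φ k)) 0)) (fun k => hlip _)
    (fun k t => ⟨_, hevol _ (le_max_right _ _), rfl⟩)
  set U : ℕ → ℝ := fun k => T (φ (ψ k)) with hU
  have hUtop : Tendsto U atTop atTop :=
    hTtop.comp (hφ.tendsto_atTop.comp hψ.tendsto_atTop)
  have hUσ : ∀ᵐ t ∂(volume : Measure ℝ), Tendsto (fun k => σ (t + U k)) atTop (𝓝 (η t)) := by
    filter_upwards [hσlim] with t ht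
    exact ht.comp hψ.tendsto_atTop
  have hηsw := (hSsub hη).1
  have hmem := aux_mem_s7 hC.isClosed hev hηsw hxlim hξ.continuous hUtop hUσ
  have htr := aux_traj hf htraj hfc hC.isClosed inter_subset_right hL hev hηsw hxlim
    hξ.continuous hUtop hUσ
  have hzero := aux_zero hC (hconth.mono (inter_subset_left.trans hKsub)) hev
    (by simpa using hlip 0) hηsw hτ (hSsub hσ) hwm hxlim hξ.continuous hUtop
    (fun k l hkl => hTsp _ _ (hφ (hψ hkl))) hUσ
  have h0 : ξ 0 ∈ P := by
    refine ⟨(ξ 0, η 0), ?_, rfl⟩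
    refine mem_sUnion.mpr ⟨range (fun t => (ξ t, η t)), ⟨?_, ?_⟩, ⟨0, rfl⟩⟩
    · rintro _ ⟨t, rfl⟩
      exact ⟨hzero t, (hmem t).2⟩
    · rintro _ ⟨t, rfl⟩
      refine ⟨(fun r => ξ (r + t), fun r => η (r + t)), ⟨?_, ?_⟩, by simp, by simp,
        fun r => ⟨r + t, rfl⟩⟩
      · have hS := aux_shift hP hσ hη hUtop hUσ t
        refine ⟨(hSsub hS).1, univ_nonempty, ordConnected_univ,
          (hξ.continuous.comp (continuous_add_const t)).continuousOn,
          fun r _ => (hmem (r + t)).2, fun a _ b _ => ?_⟩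
        obtain ⟨h1, h2⟩ := htr.intg (a + t) (mem_univ _) (b + t) (mem_univ _)
        refine ⟨by simpa using h1.comp_add_right t, ?_⟩
        show ξ (b + t) = ξ (a + t) + ∫ s in a..b, f (ξ (s + t), η (s + t))
        rw [intervalIntegral.integral_comp_add_right (fun s => f (ξ s, η s))]
        exact h2
      · exact aux_shift hP hσ hη hUtop hUσ t
  have hlim0 : Tendsto (fun k => Metric.infDist (x (U k)) P) atTop (𝓝 0) := by
    have h1 := aux_pair (σ := fun _ => ()) (η := fun _ => ()) hxlim hUtop (t := 0)
      tendsto_const_nhds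
    have h2 : Tendsto (fun k => x (U k)) atTop (𝓝 (ξ 0)) := by
      have h3 := (continuous_fst.tendsto _).comp h1
      refine h3.congr fun k => ?_
      simp [Function.comp, hU]
    have h3 := ((Metric.continuous_infDist_pt P).tendsto (ξ 0)).comp h2
    rwa [Metric.infDist_zero_of_mem h0] at h3
  have := ge_of_tendsto hlim0 (Eventually.of_forall fun k => hTbad (φ (ψ k)))
  linarith
end
end

section
/- Let (x,σ) be a forward complete trajectory of the switched system ẋ = f(x,σ) with σ ∈ S_a. Then: (1) if (x,σ) satisfies Assumption (A3), there exists c ∈ ℝ such that x → ∪_{γ,γ′∈Γ} ( O_γ^f(f_γ,W_γ) ∩ O_{γ′}^b(f_{γ′},W_{γ′}) ∩ V_γ⁻¹(c) ∩ V_{γ′}⁻¹(c) ); (2) if (x,σ) satisfies Assumption (A4), then x → ∪_{γ,γ′∈Γ} ( O_γ^f(f_γ,W_γ) ∩ O_{γ′}^b(f_{γ′},W_{γ′}) ); (3) if Γ is finite (identified with {1,…,N}) and (x,σ) satisfies Assumption (A5), there exists c⃗ = (c₁,…,c_N) ∈ ℝᴺ such that x → ∪_{γ,γ′∈Γ} (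 O_γ^f(f_γ,W_γ) ∩ O_{γ′}^b(f_{γ′},W_{γ′}) ∩ V_γ⁻¹(c_γ) ∩ V_{γ′}⁻¹(c_{γ′}) ). -/
open Filter Topology MeasureTheory Set

section Helpers

lemma signal_locConst {Γ : Type*} [MetricSpace Γ] {σ : ℝ → Γ} (hσ : IsSwitchingSignal σ)
    {t : ℝ} (ht : ContinuousAt σ t) : ∀ᶠ s in 𝓝 t, σ s = σ t := by
  obtain ⟨e1, he1, h1⟩ := hσ.rightConst t
  obtain ⟨e2, he2, h2⟩ := hσ.leftConst t
  have hleft : ∀ s ∈ Set.Ioo (t - e2) t, σ s = σ t := by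
    intro s hs
    have hT : Tendsto σ (𝓝[<] t) (𝓝 (σ t)) := ht.tendsto.mono_left nhdsWithin_le_nhds
    have hc : Tendsto σ (𝓝[<] t) (𝓝 (σ s)) := by
      refine (tendsto_const_nhds (x := σ s)).congr' ?_
      filter_upwards [Ioo_mem_nhdsLT (show t - e2 < t by linarith)] with r hr
      exact h2 s hs r hr
    exact tendsto_nhds_unique hc hT
  filter_upwards [Ioo_mem_nhds (show t - e2 < t by linarith) (show t < t + e1 by linarith)]
    with s hs
  rcases lt_or_ge s t with h | h
  · exact hleft s ⟨hs.1, h⟩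
  · exact h1 s ⟨h, hs.2⟩

lemma signal_const {Γ : Type*} [MetricSpace Γ] {σ : ℝ → Γ} (hσ : IsSwitchingSignal σ)
    {a b : ℝ} (h : ∀ t ∈ Set.Icc a b, t ∉ JumpTimes σ) :
    ∀ s ∈ Set.Icc a b, ∀ t ∈ Set.Icc a b, σ s = σ t := by
  have hlc : IsLocallyConstant (fun s : Set.Icc a b => σ s) := by
    rw [IsLocallyConstant.iff_eventually_eq]
    intro s
    have h1 : ContinuousAt σ s := by
      have := h s s.2
      simpa [JumpTimes] using this
    exact continuous_subtype_val.continuousAt.eventually (signal_locConst hσ h1)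
  haveI : PreconnectedSpace (Set.Icc a b) := Subtype.preconnectedSpace isPreconnected_Icc
  intro s hs t ht
  exact hlc.apply_eq_of_preconnectedSpace ⟨s, hs⟩ ⟨t, ht⟩

lemma exists_gap {Γ : Type*} [MetricSpace Γ] {σ : ℝ → Γ} (hσ : σ ∈ SAall Γ)
    {η : ℝ} (hη : 0 < η) : ∃ δ > (0:ℝ), ∀ t : ℝ, ∃ u : ℝ, t ≤ u - δ ∧ u + δ ≤ t + η ∧
      ∀ s ∈ Set.Icc (u - δ) (u + δ), s ∉ JumpTimes σ := by
  simp only [SAall, Set.mem_iUnion, Set.mem_Ioi] at hσ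
  obtain ⟨τD, hτ, N₀, hs, hcard⟩ := hσ
  obtain ⟨N, hN⟩ := exists_nat_ge ((N₀ : ℝ) + η / τD)
  set h : ℝ := η / (N + 2) with hh
  have hN2 : (0:ℝ) < N + 2 := by positivity
  have hpos : 0 < h := by positivity
  have hmul : h * (N + 2) = η := by rw [hh]; field_simp
  refine ⟨h / 3, by positivity, fun t => ?_⟩
  by_contra hcon
  push Not at hcon
  have key : ∀ i : Fin (N + 1), ∃ s ∈ Set.Icc (t + ((i : ℕ) + 1) * h - h / 3)
      (t + ((i : ℕ) + 1) * h + h / 3), s ∈ JumpTimes σ := by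
    intro i
    apply hcon
    · have : (0:ℝ) ≤ (i : ℕ) := by positivity
      nlinarith
    · have : ((i : ℕ) : ℝ) ≤ N := by exact_mod_cast Nat.lt_succ_iff.mp i.2
      nlinarith
  choose g hg1 hg2 using key
  have hlt : ∀ i j : Fin (N + 1), i < j → g i < g j := by
    intro i j hij
    have h1 := (hg1 i).2
    have h2 := (hg1 j).1
    have h3 : ((i : ℕ) : ℝ) + 1 ≤ (j : ℕ) := by exact_mod_cast hij
    nlinarith
  have hinj : Function.Injective g := (show StrictMono g from fun i j h => hlt i j h).injective
  have hfin : (JumpTimes σ ∩ Set.Ioo t (t + η)).Finite :=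
    (hs.locFinite t (t + η)).subset (Set.inter_subset_inter_right _ Set.Ioo_subset_Icc_self)
  have hsub : Set.range g ⊆ JumpTimes σ ∩ Set.Ioo t (t + η) := by
    rintro _ ⟨i, rfl⟩
    have h0 : (0:ℝ) ≤ (i : ℕ) := by positivity
    have h1 : ((i : ℕ) : ℝ) ≤ N := by exact_mod_cast Nat.lt_succ_iff.mp i.2
    have h2 := (hg1 i).1
    have h3 := (hg1 i).2
    exact ⟨hg2 i, by nlinarith, by nlinarith⟩
  have hc1 := Set.ncard_le_ncard hsub hfin
  have hc2 : (Set.range g).ncard = N + 1 := by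
    rw [← Set.image_univ, Set.ncard_image_of_injective _ hinj, Set.ncard_univ]; simp
  have hc3 := hcard t (t + η) (by linarith)
  rw [add_sub_cancel_left] at hc3
  have : ((N + 1 : ℕ) : ℝ) ≤ N := by
    rw [← hc2]; exact (Nat.cast_le.mpr hc1).trans (hc3.trans hN)
  push_cast at this
  linarith

/-- Derivative from the integral equation. -/
lemma hasDerivAt_of_integral {n : ℕ} {y g : ℝ → Eucl n} {a b : ℝ}
    (hg : ContinuousOn g (Set.Icc a b))
    (hy : ∀ t ∈ Set.Icc a b, y t = y a + ∫ s in a..t, g s) {t : ℝ} (ht : t ∈ Set.Ioo a b) :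
    HasDerivAt y (g t) t := by
  have hab : a ≤ t := ht.1.le
  have hn : Set.Icc a b ∈ 𝓝 t := Icc_mem_nhds ht.1 ht.2
  have h1 : HasDerivAt (fun r => ∫ s in a..r, g s) (g t) t := by
    refine intervalIntegral.integral_hasDerivAt_right ?_ ?_ (hg.continuousAt hn)
    · apply ContinuousOn.intervalIntegrable
      rw [Set.uIcc_of_le hab]
      exact hg.mono (Set.Icc_subset_Icc_right ht.2.le)
    · exact ContinuousOn.stronglyMeasurableAtFilter isOpen_Ioo
        (hg.mono Set.Ioo_subset_Icc_self) t ht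
  refine (h1.const_add (y a)).congr_of_eventuallyEq ?_
  filter_upwards [hn] with r hr
  exact hy r hr

/-- Limit data. -/
structure LimData {n : ℕ} {Γ : Type*} [MetricSpace Γ]
    (f : Eucl n × Γ → Eucl n) (domf : Set (Eucl n × Γ)) (B : Set (Eucl n))
    (x : ℝ → Eucl n) (σ : ℝ → Γ) (δ : ℝ) (U : Ultrafilter ℝ) (u : ℝ → ℝ) (γ : Γ)
    (φ : ℝ → Eucl n) : Prop where
  pos : 0 < δ
  top : Tendsto u U atTop
  cst : ∀ᶠ t in (U : Filter ℝ), 0 ≤ u t - δ ∧ ∀ s ∈ Set.Icc (-δ) δ, σ (u t + s) = σ (u t)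
  lim : Tendsto (fun t => σ (u t)) U (𝓝 γ)
  conv : ∀ s : ℝ → ℝ, ∀ s₀ ∈ Set.Icc (-δ) δ, (∀ᶠ t in (U : Filter ℝ), s t ∈ Set.Icc (-δ) δ) →
    Tendsto s U (𝓝 s₀) → Tendsto (fun t => x (u t + s t)) U (𝓝 (φ s₀))
  sol : IsSolOn (fun ξ => f (ξ, γ)) {ξ | ξ ∈ B ∧ (ξ, γ) ∈ domf} φ (Set.Icc (-δ) δ)

lemma traj_bound {n : ℕ} {Γ : Type*} [MetricSpace Γ] [CompactSpace Γ]
    {f : Eucl n × Γ → Eucl n} {domf : Set (Eucl n × Γ)}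
    (hdomf : IsClosed domf) (hf : ContinuousOn f domf)
    {x : ℝ → Eucl n} {σ : ℝ → Γ} {Ix : Set ℝ}
    (htraj : IsTrajectory f domf x σ Ix) (hfc : Set.Ici (0 : ℝ) ⊆ Ix)
    {B : Set (Eucl n)} (hB : IsCompact B) (hxB : ∀ t ∈ Ix, x t ∈ B) :
    ∃ L > (0:ℝ), ∀ a, 0 ≤ a → ∀ b, 0 ≤ b → ‖x b - x a‖ ≤ L * |b - a| := by
  have hK : IsCompact ((B ×ˢ (Set.univ : Set Γ)) ∩ domf) :=
    (hB.prod isCompact_univ).inter_right hdomf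
  obtain ⟨C, hC⟩ := hK.exists_bound_of_continuousOn (hf.mono Set.inter_subset_right)
  refine ⟨max C 1, by positivity, fun a ha b hb => ?_⟩
  have h := (htraj.intg a (hfc ha) b (hfc hb)).2
  rw [h, add_sub_cancel_left]
  apply intervalIntegral.norm_integral_le_of_norm_le_const
  intro s hs
  have hs0 : s ∈ Set.Ici (0:ℝ) := by
    have := hs.1
    exact ((le_min ha hb).trans_lt this).le
  exact (hC _ ⟨⟨hxB s (hfc hs0), trivial⟩, htraj.mem s (hfc hs0)⟩).trans (le_max_left _ _)

lemma core {n : ℕ} {Γ : Type*} [MetricSpace Γ] [CompactSpace Γ]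
    {f : Eucl n × Γ → Eucl n} {domf : Set (Eucl n × Γ)}
    (hdomf : IsClosed domf) (hf : ContinuousOn f domf)
    {x : ℝ → Eucl n} {σ : ℝ → Γ} {Ix : Set ℝ}
    (htraj : IsTrajectory f domf x σ Ix) (hfc : Set.Ici (0 : ℝ) ⊆ Ix)
    (hσ : σ ∈ SAall Γ)
    {B : Set (Eucl n)} (hB : IsCompact B) (hxB : ∀ t ∈ Ix, x t ∈ B)
    {P : ℝ → Prop} (hP : ∃ᶠ t in atTop, P t) {ε : ℝ} (hε : 0 < ε) :
    ∃ δ U u γ φ, LimData f domf B x σ δ U u γ φ ∧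
      ∀ᶠ t in (U : Filter ℝ), P t ∧ ‖x (u t) - x t‖ ≤ ε := by
  obtain ⟨L, hL, hLip⟩ := traj_bound hdomf hf htraj hfc hB hxB
  obtain ⟨δ, hδ, hgap⟩ := exists_gap hσ (show 0 < ε / L by positivity)
  choose u hu1 hu2 hu3 using hgap
  haveI : NeBot (atTop ⊓ 𝓟 {t | P t}) := Filter.frequently_mem_iff_neBot.mp hP
  let U : Ultrafilter ℝ := Ultrafilter.of (atTop ⊓ 𝓟 {t | P t})
  have hU : (U : Filter ℝ) ≤ atTop ⊓ 𝓟 {t | P t} := Ultrafilter.of_le _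
  have hUtop : (U : Filter ℝ) ≤ atTop := hU.trans inf_le_left
  have hUP : ∀ᶠ t in (U : Filter ℝ), P t := (hU.trans inf_le_right) (mem_principal_self _)
  have htop : Tendsto u U atTop :=
    tendsto_atTop_mono (fun t => (by linarith [hu1 t] : t ≤ u t)) hUtop
  have h0 : ∀ᶠ t in (U : Filter ℝ), (0:ℝ) ≤ t := hUtop (eventually_ge_atTop 0)
  have hcst : ∀ t, ∀ s ∈ Set.Icc (-δ) δ, σ (u t + s) = σ (u t) := fun t s hs =>
    signal_const htraj.signal (hu3 t) _ ⟨by linarith [hs.1], by linarith [hs.2]⟩ _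
      ⟨by linarith, by linarith⟩
  -- limits
  obtain ⟨γ, -, hγ⟩ := isCompact_univ.ultrafilter_le_nhds (U.map (fun t => σ (u t)))
    (by simp)
  have hγ' : Tendsto (fun t => σ (u t)) U (𝓝 γ) := hγ
  have hex : ∀ s : ℝ, ∃ ξ, s ∈ Set.Icc (-δ) δ → ξ ∈ B ∧ Tendsto (fun t => x (u t + s)) U (𝓝 ξ) := by
    intro s
    by_cases hs : s ∈ Set.Icc (-δ) δ
    · obtain ⟨ξ, h1, h2⟩ := hB.ultrafilter_le_nhds (U.map (fun t => x (u t + s))) (by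
        rw [le_principal_iff]
        change ∀ᶠ t in (U : Filter ℝ), x (u t + s) ∈ B
        filter_upwards [h0] with t ht
        exact hxB _ (hfc (show (0:ℝ) ≤ u t + s by linarith [hu1 t, hs.1])))
      exact ⟨ξ, fun _ => ⟨h1, h2⟩⟩
    · exact ⟨0, fun h => absurd h hs⟩
  choose φ hφ using hex
  have hconv : ∀ s : ℝ → ℝ, ∀ s₀ ∈ Set.Icc (-δ) δ,
      (∀ᶠ t in (U : Filter ℝ), s t ∈ Set.Icc (-δ) δ) →
      Tendsto s U (𝓝 s₀) → Tendsto (fun t => x (u t + s t)) U (𝓝 (φ s₀)) := by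
    intro s s₀ hs₀ hs hlim
    have h1 := (hφ s₀ hs₀).2
    have h2 : Tendsto (fun t => x (u t + s t) - x (u t + s₀)) U (𝓝 0) := by
      have h3 : Tendsto (fun t => L * |s t - s₀|) U (𝓝 0) := by
        have := ((hlim.sub_const s₀).abs).const_mul L
        simpa using this
      refine squeeze_zero_norm' ?_ h3
      filter_upwards [h0, hs] with t ht hst
      have := hLip (u t + s₀) (by linarith [hu1 t, hs₀.1]) (u t + s t) (by linarith [hu1 t, hst.1])
      simpa using this
    simpa using h2.add h1
  have hdom : ∀ s ∈ Set.Icc (-δ) δ, (φ s, γ) ∈ domf := by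
    intro s hs
    refine hdomf.mem_of_tendsto ((hφ s hs).2.prodMk_nhds hγ') ?_
    filter_upwards [h0] with t ht
    have := htraj.mem (u t + s) (hfc (show (0:ℝ) ≤ u t + s by linarith [hu1 t, hs.1]))
    rwa [hcst t s hs] at this
  have hφLip : ∀ a ∈ Set.Icc (-δ) δ, ∀ b ∈ Set.Icc (-δ) δ, ‖φ b - φ a‖ ≤ L * |b - a| := by
    intro a ha b hb
    refine le_of_tendsto (((hφ b hb).2.sub (hφ a ha).2).norm) ?_
    filter_upwards [h0] with t ht
    have := hLip (u t + a) (by linarith [hu1 t, ha.1]) (u t + b) (by linarith [hu1 t, hb.1])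
    simpa using this
  have hφc : ContinuousOn φ (Set.Icc (-δ) δ) := by
    have : LipschitzOnWith L.toNNReal φ (Set.Icc (-δ) δ) := by
      refine LipschitzOnWith.of_dist_le_mul fun a ha b hb => ?_
      rw [dist_eq_norm, Real.dist_eq, Real.coe_toNNReal _ hL.le]
      exact hφLip b hb a ha
    exact this.continuousOn
  have hfc' : ContinuousOn (fun s => f (φ s, γ)) (Set.Icc (-δ) δ) :=
    hf.comp (hφc.prodMk continuousOn_const) hdom
  -- uniform convergence of the right-hand side
  have hunif : ∀ e > (0:ℝ), ∀ᶠ t in (U : Filter ℝ), ∀ s ∈ Set.Icc (-δ) δ,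
      ‖f (x (u t + s), σ (u t)) - f (φ s, γ)‖ ≤ e := by
    intro e he
    by_contra hcon
    rw [← Ultrafilter.eventually_not] at hcon
    have hch : ∀ t, ∃ s, s ∈ Set.Icc (-δ) δ ∧
        ((∃ r ∈ Set.Icc (-δ) δ, e < ‖f (x (u t + r), σ (u t)) - f (φ r, γ)‖) →
          e < ‖f (x (u t + s), σ (u t)) - f (φ s, γ)‖) := by
      intro t
      by_cases h : ∃ r ∈ Set.Icc (-δ) δ, e < ‖f (x (u t + r), σ (u t)) - f (φ r, γ)‖
      · obtain ⟨r, hr, hr'⟩ := h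
        exact ⟨r, hr, fun _ => hr'⟩
      · exact ⟨0, ⟨by linarith, hδ.le⟩, fun h' => absurd h' h⟩
    choose s hs hs' using hch
    obtain ⟨s₀, hs₀, hlim⟩ := isCompact_Icc.ultrafilter_le_nhds (U.map s) (by
      rw [le_principal_iff]
      exact Filter.Eventually.of_forall (f := (U : Filter ℝ)) hs)
    have hlim' : Tendsto s U (𝓝 s₀) := hlim
    have hx1 := hconv s s₀ hs₀ (Filter.Eventually.of_forall hs) hlim'
    have hA : Tendsto (fun t => f (x (u t + s t), σ (u t))) U (𝓝 (f (φ s₀, γ))) := by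
      refine (hf (φ s₀, γ) (hdom s₀ hs₀)).tendsto.comp
        (tendsto_nhdsWithin_iff.mpr ⟨hx1.prodMk_nhds hγ', ?_⟩)
      filter_upwards [h0] with t ht
      have := htraj.mem (u t + s t) (hfc (show (0:ℝ) ≤ u t + s t by linarith [hu1 t, (hs t).1]))
      rwa [hcst t _ (hs t)] at this
    have hBt : Tendsto (fun t => f (φ (s t), γ)) U (𝓝 (f (φ s₀, γ))) :=
      (hfc' s₀ hs₀).tendsto.comp
        (tendsto_nhdsWithin_iff.mpr ⟨hlim', Filter.Eventually.of_forall hs⟩)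
    have hD := (hA.sub hBt).norm
    rw [sub_self, norm_zero] at hD
    obtain ⟨t, ht1, ht2⟩ := (hcon.and (hD.eventually (gt_mem_nhds he))).exists
    push Not at ht1
    exact absurd (hs' t ht1) (not_lt.mpr ht2.le)
  have hint : ∀ a ∈ Set.Icc (-δ) δ, ∀ b ∈ Set.Icc (-δ) δ,
      IntervalIntegrable (fun s => f (φ s, γ)) volume a b := fun a ha b hb =>
    (hfc'.mono (Set.ordConnected_Icc.uIcc_subset ha hb)).intervalIntegrable
  refine ⟨δ, U, u, γ, φ, ⟨hδ, htop, ?_, hγ', hconv, hφc, fun s hs => ⟨(hφ s hs).1, hdom s hs⟩, ?_⟩, ?_⟩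
  · filter_upwards [h0] with t ht
    exact ⟨by linarith [hu1 t], hcst t⟩
  · intro a ha b hb
    refine ⟨hint a ha b hb, ?_⟩
    have hlimI : Tendsto (fun t => x (u t + b) - x (u t + a)) U
        (𝓝 (∫ s in a..b, f (φ s, γ))) := by
      rw [Metric.tendsto_nhds]
      intro e he
      have he' : 0 < e / (2 * δ + 1) := by positivity
      filter_upwards [hunif _ he', h0] with t ht ht0
      have ha0 : (0:ℝ) ≤ u t + a := by linarith [hu1 t, ha.1]
      have hb0 : (0:ℝ) ≤ u t + b := by linarith [hu1 t, hb.1]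
      have hI := htraj.intg (u t + a) (hfc ha0) (u t + b) (hfc hb0)
      have hsubst : ∫ s in a..b, f (x (u t + s), σ (u t + s)) =
          ∫ s in (u t + a)..(u t + b), f (x s, σ s) :=
        intervalIntegral.integral_comp_add_left (fun s => f (x s, σ s)) (u t)
      have hint2 : IntervalIntegrable (fun s => f (x (u t + s), σ (u t + s))) volume a b := by
        have := hI.1.comp_add_left (u t)
        simpa using this
      have : x (u t + b) - x (u t + a) - ∫ s in a..b, f (φ s, γ) =
          ∫ s in a..b, (f (x (u t + s), σ (u t + s)) - f (φ s, γ)) := by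
        rw [intervalIntegral.integral_sub hint2 (hint a ha b hb), hsubst, hI.2]
        abel
      rw [dist_eq_norm, this]
      have hle : ‖∫ s in a..b, (f (x (u t + s), σ (u t + s)) - f (φ s, γ))‖ ≤
          e / (2 * δ + 1) * |b - a| := by
        apply intervalIntegral.norm_integral_le_of_norm_le_const
        intro s hs
        have hs' := Set.ordConnected_Icc.uIcc_subset ha hb (Set.uIoc_subset_uIcc hs)
        rw [hcst t s hs']
        exact ht s hs'
      have hab : |b - a| ≤ 2 * δ := by
        rw [abs_le]; constructor <;> linarith [ha.1, ha.2, hb.1, hb.2]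
      calc _ ≤ _ := hle
        _ ≤ e / (2 * δ + 1) * (2 * δ) := by gcongr
        _ < e / (2 * δ + 1) * (2 * δ + 1) := by gcongr; linarith
        _ = e := by field_simp
    have h1 := tendsto_nhds_unique hlimI ((hφ b hb).2.sub (hφ a ha).2)
    rw [h1]; abel
  · filter_upwards [h0, hUP] with t ht hPt
    refine ⟨hPt, (hLip t ht (u t) (by linarith [hu1 t])).trans ?_⟩
    have : |u t - t| ≤ ε / L := by
      rw [abs_le]; constructor <;> linarith [hu1 t, hu2 t, show 0 < ε / L by positivity]
    calc _ ≤ L * (ε / L) := by gcongr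
      _ = ε := by field_simp

lemma conv_of_limData {n : ℕ} {Γ : Type*} [MetricSpace Γ] [CompactSpace Γ]
    {f : Eucl n × Γ → Eucl n} {domf : Set (Eucl n × Γ)}
    (hdomf : IsClosed domf) (hf : ContinuousOn f domf)
    {x : ℝ → Eucl n} {σ : ℝ → Γ} {Ix : Set ℝ}
    (htraj : IsTrajectory f domf x σ Ix) (hfc : Set.Ici (0 : ℝ) ⊆ Ix)
    (hσ : σ ∈ SAall Γ)
    {B : Set (Eucl n)} (hB : IsCompact B) (hxB : ∀ t ∈ Ix, x t ∈ B) {M : Set (Eucl n)}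
    (h : ∀ δ U u γ φ, LimData f domf B x σ δ U u γ φ → φ 0 ∈ M) : ConvergesTo x M := by
  rw [ConvergesTo, Metric.tendsto_nhds]
  intro e he
  by_contra hcon
  have hfr : ∃ᶠ t in atTop, e ≤ Metric.infDist (x t) M := by
    refine (Filter.not_eventually.mp hcon).mono fun t ht => ?_
    rw [Real.dist_eq, sub_zero, abs_of_nonneg Metric.infDist_nonneg] at ht
    exact not_lt.mp ht
  obtain ⟨δ, U, u, γ, φ, hD, hev⟩ := core hdomf hf htraj hfc hσ hB hxB hfr (half_pos he)
  have h0 := h _ _ _ _ _ hD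
  have hm : (0:ℝ) ∈ Set.Icc (-δ) δ := ⟨by linarith [hD.pos], hD.pos.le⟩
  have hl : Tendsto (fun t => x (u t)) U (𝓝 (φ 0)) := by
    simpa using hD.conv (fun _ => 0) 0 hm (Filter.Eventually.of_forall fun _ => hm)
      tendsto_const_nhds
  have hl2 := ((Metric.continuous_infDist_pt M).tendsto (φ 0)).comp hl
  rw [Metric.infDist_zero_of_mem h0] at hl2
  obtain ⟨t, ht1, ht2, ht3⟩ := ((hl2.eventually (gt_mem_nhds (half_pos he))).and hev).exists
  have := Metric.infDist_le_infDist_add_dist (s := M) (x := x t) (y := x (u t))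
  rw [dist_comm, dist_eq_norm] at this
  simp only [Function.comp] at ht1
  linarith

lemma tendsto_sInf_of_antitoneOn {v : ℝ → ℝ} {S : Set ℝ} (hv : AntitoneOn v S)
    (hb : BddBelow (v '' S)) {F : Filter ℝ} [NeBot F] {y : ℝ → ℝ} (hy : Tendsto y F atTop)
    (hS : ∀ᶠ t in F, y t ∈ S) : Tendsto (fun t => v (y t)) F (𝓝 (sInf (v '' S))) := by
  obtain ⟨t₀, ht₀⟩ := hS.exists
  have hne : (v '' S).Nonempty := ⟨_, _, ht₀, rfl⟩
  rw [tendsto_order]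
  constructor
  · intro a ha
    filter_upwards [hS] with t ht
    exact ha.trans_le (csInf_le hb ⟨_, ht, rfl⟩)
  · intro a ha
    obtain ⟨_, ⟨r, hr, rfl⟩, hlt⟩ := exists_lt_of_csInf_lt hne ha
    filter_upwards [hS, hy.eventually_ge_atTop r] with t ht htr
    exact (hv hr ht htr).trans_lt hlt

lemma isSolOn_mono {n : ℕ} {g : Eucl n → Eucl n} {X Y : Set (Eucl n)} {φ : ℝ → Eucl n}
    {I J : Set ℝ} (h : IsSolOn g X φ I) (hJ : J ⊆ I) (hX : X ⊆ Y) : IsSolOn g Y φ J :=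
  ⟨h.1.mono hJ, fun t ht => hX (h.2.1 t (hJ ht)), fun a ha b hb => h.2.2 a (hJ ha) b (hJ hb)⟩

lemma mem_sets_of_sol {n : ℕ} {g : Eucl n → Eucl n} {X : Set (Eucl n)} {φ : ℝ → Eucl n}
    {w : Eucl n → ℝ} {δ : ℝ} (hδ : 0 < δ) (h : IsSolOn g X φ (Set.Icc (-δ) δ))
    (hw : ∀ s ∈ Set.Ioo (-δ) δ, w (φ s) = 0) :
    φ 0 ∈ XFwdFin X g w ∩ XBwdFin X g w := by
  simp only [XFwdFin, XBwdFin, Set.mem_inter_iff, Set.mem_iUnion, Set.mem_Ioi]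
  refine ⟨⟨δ / 2, half_pos hδ, φ, isSolOn_mono h ?_ subset_rfl, rfl, ?_⟩,
    ⟨δ / 2, half_pos hδ, φ, isSolOn_mono h ?_ subset_rfl, rfl, ?_⟩⟩
  · exact Set.Icc_subset_Icc (by linarith) (by linarith)
  · exact fun t ht => hw t ⟨by linarith [ht.1], by linarith [ht.2]⟩
  · exact Set.Icc_subset_Icc (by linarith) (by linarith)
  · exact fun t ht => hw t ⟨by linarith [ht.1], by linarith [ht.2]⟩

/-- Derivative of `V_γ` along a solution. -/
lemma hasDerivAt_V {n : ℕ} {Γ : Type*} [MetricSpace Γ]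
    {f : Eucl n × Γ → Eucl n} {domf domV : Set (Eucl n × Γ)} {V : Eucl n × Γ → ℝ}
    (hf : ContinuousOn f domf) (hV : ClassVFun V domV domf) {y : ℝ → Eucl n} {a b : ℝ} {γ : Γ}
    (hy : IsSolOn (fun ξ => f (ξ, γ)) (Ogamma domV domf γ) y (Set.Icc a b))
    {t : ℝ} (ht : t ∈ Set.Ioo a b) :
    HasDerivAt (fun s => V (y s, γ)) (fderiv ℝ (fun ξ' => V (ξ', γ)) (y t) (f (y t, γ))) t := by
  have ha : a ∈ Set.Icc a b := ⟨le_rfl, (ht.1.trans ht.2).le⟩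
  have hc : ContinuousOn (fun s => f (y s, γ)) (Set.Icc a b) :=
    hf.comp (hy.1.prodMk continuousOn_const) fun s hs => (hy.2.1 s hs).2
  have h1 : HasDerivAt y (f (y t, γ)) t :=
    hasDerivAt_of_integral (g := fun s => f (y s, γ)) hc
      (fun r hr => (hy.2.2 a ha r hr).2) ht
  have h2 := (hV.diff γ (y t) (hy.2.1 t ⟨ht.1.le, ht.2.le⟩)).hasFDerivAt
  exact h2.comp_hasDerivAt t h1

lemma W_zero_of_const {n : ℕ} {Γ : Type*} [MetricSpace Γ]
    {f : Eucl n × Γ → Eucl n} {domf domV : Set (Eucl n × Γ)} {V W : Eucl n × Γ → ℝ}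
    (hf : ContinuousOn f domf) (hV : ClassVFun V domV domf) (hW : Wineq f V W domV domf)
    {y : ℝ → Eucl n} {a b c : ℝ} {γ : Γ}
    (hy : IsSolOn (fun ξ => f (ξ, γ)) (Ogamma domV domf γ) y (Set.Icc a b))
    (hc : ∀ s ∈ Set.Icc a b, V (y s, γ) = c) :
    ∀ t ∈ Set.Ioo a b, W (y t, γ) = 0 := by
  intro t ht
  have h1 := hasDerivAt_V hf hV hy ht
  have h2 : HasDerivAt (fun s => V (y s, γ)) 0 t := by
    refine (hasDerivAt_const t c).congr_of_eventuallyEq ?_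
    filter_upwards [Icc_mem_nhds ht.1 ht.2] with s hs
    exact hc s hs
  have h3 := h1.unique h2
  have h4 := hW γ (y t) (hy.2.1 t ⟨ht.1.le, ht.2.le⟩)
  rw [h3] at h4
  linarith [h4.1, h4.2]

end Helpers

noncomputable section
theorem convergence_criteria
    {n : ℕ} {Γ : Type*} [MetricSpace Γ] [CompactSpace Γ]
    (f : Eucl n × Γ → Eucl n) (domf : Set (Eucl n × Γ))
    (hdomf : IsClosed domf) (hf : ContinuousOn f domf)
    (x : ℝ → Eucl n) (σ : ℝ → Γ) (Ix : Set ℝ)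
    (htraj : IsTrajectory f domf x σ Ix) (hfc : Set.Ici (0 : ℝ) ⊆ Ix)
    (hσ : σ ∈ SAall Γ)
    (V : Eucl n × Γ → ℝ) (domV : Set (Eucl n × Γ)) (W : Eucl n × Γ → ℝ) :
    ((AssumptionA1 domf V domV x σ Ix ∧ Wineq f V W domV domf) →
      ∃ c : ℝ, ConvergesTo x (⋃ γ : Γ, ⋃ γ' : Γ,
        XFwdFin (Ogamma domV domf γ) (fun ξ => f (ξ, γ)) (fun ξ => W (ξ, γ)) ∩
        XBwdFin (Ogamma domV domf γ') (fun ξ => f (ξ, γ')) (fun ξ => W (ξ, γ')) ∩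
        {ξ : Eucl n | V (ξ, γ) = c} ∩ {ξ : Eucl n | V (ξ, γ') = c})) ∧
    (AssumptionA4 f domf V domV W x σ Ix →
      ConvergesTo x (⋃ γ : Γ, ⋃ γ' : Γ,
        XFwdFin (Ogamma domV domf γ) (fun ξ => f (ξ, γ)) (fun ξ => W (ξ, γ)) ∩
        XBwdFin (Ogamma domV domf γ') (fun ξ => f (ξ, γ')) (fun ξ => W (ξ, γ')))) ∧
    (Finite Γ → (AssumptionA2 domf V domV x σ Ix ∧ Wineq f V W domV domf) →
      ∃ c : Γ → ℝ, ConvergesTo x (⋃ γ : Γ, ⋃ γ' : Γ,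
        XFwdFin (Ogamma domV domf γ) (fun ξ => f (ξ, γ)) (fun ξ => W (ξ, γ)) ∩
        XBwdFin (Ogamma domV domf γ') (fun ξ => f (ξ, γ')) (fun ξ => W (ξ, γ')) ∩
        {ξ : Eucl n | V (ξ, γ) = c γ} ∩ {ξ : Eucl n | V (ξ, γ') = c γ'})) := by
  refine ⟨?_, ?_, ?_⟩
  · rintro ⟨hA, hW⟩
    obtain ⟨B, hBO, hB, hxB⟩ := hA.precompact
    have hK : IsCompact ((B ×ˢ (Set.univ : Set Γ)) ∩ domf) :=
      (hB.prod isCompact_univ).inter_right hdomf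
    have hKsub : (B ×ˢ (Set.univ : Set Γ)) ∩ domf ⊆
        domf ∩ (Oset domV ×ˢ (Set.univ : Set Γ)) := fun p hp => ⟨hp.2, hBO hp.1.1, trivial⟩
    have hbdd : BddBelow ((fun t => V (x t, σ t)) '' Set.Ici 0) := by
      refine (hK.image_of_continuousOn (hA.contV.mono hKsub)).bddBelow.mono ?_
      rintro _ ⟨t, ht, rfl⟩
      exact ⟨(x t, σ t), ⟨⟨hxB t (hfc ht), trivial⟩, htraj.mem t (hfc ht)⟩, rfl⟩
    refine ⟨sInf ((fun t => V (x t, σ t)) '' Set.Ici 0),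
      conv_of_limData hdomf hf htraj hfc hσ hB hxB ?_⟩
    intro δ U u γ φ D
    have hsol : IsSolOn (fun ξ => f (ξ, γ)) (Ogamma domV domf γ) φ (Set.Icc (-δ) δ) :=
      isSolOn_mono D.sol subset_rfl fun ξ hξ => ⟨hBO hξ.1, hξ.2⟩
    have hcst : ∀ s ∈ Set.Icc (-δ) δ,
        V (φ s, γ) = sInf ((fun t => V (x t, σ t)) '' Set.Ici 0) := by
      intro s hs
      have htop : Tendsto (fun t => u t + s) U atTop := tendsto_atTop_add_const_right _ _ D.top
      have h1 := tendsto_sInf_of_antitoneOn hA.nonincr hbdd htop (htop.eventually_ge_atTop 0)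
      have h2 := D.conv (fun _ => s) s hs (Filter.Eventually.of_forall fun _ => hs)
        tendsto_const_nhds
      have h3 : Tendsto (fun t => V (x (u t + s), σ (u t))) U (𝓝 (V (φ s, γ))) := by
        refine (hA.contV (φ s, γ) (hKsub ⟨⟨(D.sol.2.1 s hs).1, trivial⟩,
          (D.sol.2.1 s hs).2⟩)).tendsto.comp
          (tendsto_nhdsWithin_iff.mpr ⟨h2.prodMk_nhds D.lim, ?_⟩)
        filter_upwards [D.cst] with t ht
        have h0 : (0:ℝ) ≤ u t + s := by linarith [ht.1, hs.1]
        have := htraj.mem _ (hfc h0)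
        rw [ht.2 s hs] at this
        exact hKsub ⟨⟨hxB _ (hfc h0), trivial⟩, this⟩
      refine tendsto_nhds_unique (h3.congr' ?_) h1
      filter_upwards [D.cst] with t ht
      rw [ht.2 s hs]
    have hm : (0:ℝ) ∈ Set.Icc (-δ) δ := ⟨by linarith [D.pos], D.pos.le⟩
    have hmem := mem_sets_of_sol (w := fun ξ => W (ξ, γ)) D.pos hsol
      (W_zero_of_const hf hA.classV hW hsol hcst)
    simp only [Set.mem_iUnion]
    exact ⟨γ, γ, ⟨hmem, hcst 0 hm⟩, hcst 0 hm⟩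
  · intro hA
    obtain ⟨B, hBO, hB, hxB⟩ := hA.precompact
    have hK : IsCompact ((B ×ˢ (Set.univ : Set Γ)) ∩ domf) :=
      (hB.prod isCompact_univ).inter_right hdomf
    have hKsub : (B ×ˢ (Set.univ : Set Γ)) ∩ domf ⊆
        domf ∩ (Oset domV ×ˢ (Set.univ : Set Γ)) := fun p hp => ⟨hp.2, hBO hp.1.1, trivial⟩
    have hbdd : BddBelow ((fun t => V (x t, σ t)) '' Set.Ici 0) := by
      obtain ⟨M, hM⟩ := hA.boundedV _ hKsub hK
      refine ⟨-M, ?_⟩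
      rintro _ ⟨t, ht, rfl⟩
      exact (abs_le.mp (hM (x t, σ t) ⟨⟨hxB t (hfc ht), trivial⟩, htraj.mem t (hfc ht)⟩)).1
    refine conv_of_limData hdomf hf htraj hfc hσ hB hxB ?_
    intro δ U u γ φ D
    have hsol : IsSolOn (fun ξ => f (ξ, γ)) (Ogamma domV domf γ) φ (Set.Icc (-δ) δ) :=
      isSolOn_mono D.sol subset_rfl fun ξ hξ => ⟨hBO hξ.1, hξ.2⟩
    have hdomφ : ∀ s ∈ Set.Icc (-δ) δ,
        (φ s, γ) ∈ domf ∩ (Oset domV ×ˢ (Set.univ : Set Γ)) := fun s hs =>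
      hKsub ⟨⟨(D.sol.2.1 s hs).1, trivial⟩, (D.sol.2.1 s hs).2⟩
    have hWc : ContinuousOn (fun s => W (φ s, γ)) (Set.Icc (-δ) δ) :=
      hA.contW.comp (D.sol.1.prodMk continuousOn_const) hdomφ
    have hvlim : ∀ s : ℝ, Tendsto (fun t => V (x (u t + s), σ (u t + s))) U
        (𝓝 (sInf ((fun t => V (x t, σ t)) '' Set.Ici 0))) := by
      intro s
      have htop : Tendsto (fun t => u t + s) U atTop := tendsto_atTop_add_const_right _ _ D.top
      exact tendsto_sInf_of_antitoneOn hA.nonincr hbdd htop (htop.eventually_ge_atTop 0)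
    -- in every subinterval there is a zero of `W` along `φ`
    have hzero : ∀ a b, -δ ≤ a → a < b → b ≤ δ → ∃ s ∈ Set.Icc a b, W (φ s, γ) ≤ 0 := by
      intro a b ha hab hb
      have hI : Set.Icc a b ⊆ Set.Icc (-δ) δ := Set.Icc_subset_Icc ha hb
      have ham : a ∈ Set.Icc (-δ) δ := hI ⟨le_rfl, hab.le⟩
      have hbm : b ∈ Set.Icc (-δ) δ := hI ⟨hab.le, le_rfl⟩
      have hch : ∀ t, ∃ s ∈ Set.Icc a b, (0 ≤ u t - δ ∧ ∀ s ∈ Set.Icc (-δ) δ, σ (u t + s) = σ (u t)) →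
          W (x (u t + s), σ (u t)) ≤
            (V (x (u t + a), σ (u t + a)) - V (x (u t + b), σ (u t + b))) / (b - a) := by
        intro t
        by_cases ht : 0 ≤ u t - δ ∧ ∀ s ∈ Set.Icc (-δ) δ, σ (u t + s) = σ (u t)
        · have h0 : ∀ r ∈ Set.Icc (u t - δ) (u t + δ), (0:ℝ) ≤ r := fun r hr => ht.1.trans hr.1
          have hσr : ∀ r ∈ Set.Icc (u t - δ) (u t + δ), σ r = σ (u t) := by
            intro r hr
            have := ht.2 (r - u t) ⟨by linarith [hr.1], by linarith [hr.2]⟩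
            rwa [add_sub_cancel] at this
          have hxsol : IsSolOn (fun ξ => f (ξ, σ (u t))) (Ogamma domV domf (σ (u t))) x
              (Set.Icc (u t - δ) (u t + δ)) := by
            refine ⟨htraj.cont.mono fun r hr => hfc (h0 r hr), fun r hr => ⟨hBO (hxB r (hfc (h0 r hr))), ?_⟩, ?_⟩
            · have := htraj.mem r (hfc (h0 r hr))
              rwa [hσr r hr] at this
            · intro p hp q hq
              have hI := htraj.intg p (hfc (h0 p hp)) q (hfc (h0 q hq))
              have hcg : ∀ r ∈ Set.uIcc p q, f (x r, σ r) = f (x r, σ (u t)) := fun r hr => by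
                rw [hσr r (Set.ordConnected_Icc.uIcc_subset hp hq hr)]
              refine ⟨hI.1.congr fun r hr => hcg r (Set.uIoc_subset_uIcc hr), ?_⟩
              rw [← intervalIntegral.integral_congr hcg]
              exact hI.2
          have hcont : ContinuousOn (fun s => V (x s, σ (u t))) (Set.Icc (u t + a) (u t + b)) := by
            intro s hs
            have hs' : s ∈ Set.Icc (u t - δ) (u t + δ) :=
              ⟨by linarith [hs.1], by linarith [hs.2]⟩
            have h1 : ContinuousAt (fun ξ => V (ξ, σ (u t))) (x s) :=
              (hA.classV.diff _ _ (hxsol.2.1 s hs')).continuousAt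
            exact (h1.comp_continuousWithinAt (hxsol.1 s hs')).mono
              (Set.Icc_subset_Icc (by linarith) (by linarith))
          obtain ⟨r, hr, hreq⟩ := exists_hasDerivAt_eq_slope _ _
            (show u t + a < u t + b by linarith) hcont fun s hs =>
              hasDerivAt_V hf hA.classV hxsol (t := s)
                ⟨by linarith [hs.1], by linarith [hs.2]⟩
          refine ⟨r - u t, ⟨by linarith [hr.1], by linarith [hr.2]⟩, fun _ => ?_⟩
          rw [add_sub_cancel, ht.2 a ham, ht.2 b hbm]
          have hw := (hA.wineq (σ (u t)) (x r)
            (hxsol.2.1 r ⟨by linarith [hr.1], by linarith [hr.2]⟩)).1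
          rw [hreq] at hw
          refine hw.trans (le_of_eq ?_)
          rw [← neg_div]
          congr 1 <;> ring
        · exact ⟨a, ⟨le_rfl, hab.le⟩, fun h => absurd h ht⟩
      choose s hs hs' using hch
      obtain ⟨s₀, hs₀, hlim⟩ := isCompact_Icc.ultrafilter_le_nhds (U.map s) (by
        rw [le_principal_iff]
        exact Filter.Eventually.of_forall (f := (U : Filter ℝ)) hs)
      have hlim' : Tendsto s U (𝓝 s₀) := hlim
      refine ⟨s₀, hs₀, ?_⟩
      have hx1 := D.conv s s₀ (hI hs₀) (Filter.Eventually.of_forall fun t => hI (hs t)) hlim'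
      have hWl : Tendsto (fun t => W (x (u t + s t), σ (u t))) U (𝓝 (W (φ s₀, γ))) := by
        refine (hA.contW (φ s₀, γ) (hdomφ s₀ (hI hs₀))).tendsto.comp
          (tendsto_nhdsWithin_iff.mpr ⟨hx1.prodMk_nhds D.lim, ?_⟩)
        filter_upwards [D.cst] with t ht
        have h0 : (0:ℝ) ≤ u t + s t := by linarith [ht.1, (hI (hs t)).1]
        have := htraj.mem _ (hfc h0)
        rw [ht.2 _ (hI (hs t))] at this
        exact hKsub ⟨⟨hxB _ (hfc h0), trivial⟩, this⟩
      have hR := ((hvlim a).sub (hvlim b)).div_const (b - a)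
      rw [sub_self, zero_div] at hR
      refine le_of_tendsto_of_tendsto hWl hR ?_
      filter_upwards [D.cst] with t ht
      exact hs' t ht
    have hw0 : ∀ s ∈ Set.Ioo (-δ) δ, W (φ s, γ) = 0 := by
      intro s hs
      have hnn : 0 ≤ W (φ s, γ) := (hA.wineq γ (φ s) (hsol.2.1 s ⟨hs.1.le, hs.2.le⟩)).2
      by_contra hne
      have hpos : 0 < W (φ s, γ) := lt_of_le_of_ne hnn (Ne.symm hne)
      have hn : Set.Icc (-δ) δ ∈ 𝓝 s := Icc_mem_nhds hs.1 hs.2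
      have hev := ((hWc.continuousAt hn).eventually (lt_mem_nhds hpos)).and
        (Filter.eventually_of_mem hn fun r hr => hr)
      obtain ⟨e, he, hball⟩ := Metric.eventually_nhds_iff.mp hev
      have hin : ∀ r ∈ Set.Icc (s - e / 2) (s + e / 2), dist r s < e := by
        intro r hr
        rw [Real.dist_eq, abs_lt]
        constructor <;> linarith [hr.1, hr.2]
      have h1 := (hball (hin (s - e / 2) ⟨le_rfl, by linarith⟩)).2.1
      have h2 := (hball (hin (s + e / 2) ⟨by linarith, le_rfl⟩)).2.2
      obtain ⟨r, hr, hr0⟩ := hzero _ _ h1 (by linarith) h2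
      exact absurd (hball (hin r hr)).1 (not_lt.mpr hr0)
    have hmem := mem_sets_of_sol (w := fun ξ => W (ξ, γ)) D.pos hsol hw0
    simp only [Set.mem_iUnion]
    exact ⟨γ, γ, hmem⟩
  · rintro hfin ⟨hA, hW⟩
    obtain ⟨B, hBO, hB, hxB⟩ := hA.precompact
    have hcV : ∀ γ : Γ, ∀ ξ ∈ Ogamma domV domf γ, ContinuousAt (fun ξ' => V (ξ', γ)) ξ :=
      fun γ ξ hξ => (hA.classV.diff γ ξ hξ).continuousAt
    have hbdd : ∀ γ : Γ,
        BddBelow ((fun t => V (x t, σ t)) '' ({t | σ t = γ} ∩ Set.Ici 0)) := by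
      intro γ
      have hK : IsCompact (B ∩ {ξ | (ξ, γ) ∈ domf}) :=
        hB.inter_right (hdomf.preimage (Continuous.prodMk_left γ))
      have hc : ContinuousOn (fun ξ' => V (ξ', γ)) (B ∩ {ξ | (ξ, γ) ∈ domf}) :=
        fun ξ hξ => (hcV γ ξ ⟨hBO hξ.1, hξ.2⟩).continuousWithinAt
      refine (hK.image_of_continuousOn hc).bddBelow.mono ?_
      rintro _ ⟨t, ⟨htγ, ht⟩, rfl⟩
      have hm := htraj.mem t (hfc ht)
      have htγ' : σ t = γ := htγ
      rw [htγ'] at hm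
      exact ⟨x t, ⟨hxB t (hfc ht), hm⟩, by simp only [htγ']⟩
    refine ⟨fun γ => sInf ((fun t => V (x t, σ t)) '' ({t | σ t = γ} ∩ Set.Ici 0)),
      conv_of_limData hdomf hf htraj hfc hσ hB hxB ?_⟩
    intro δ U u γ φ D
    have hsol : IsSolOn (fun ξ => f (ξ, γ)) (Ogamma domV domf γ) φ (Set.Icc (-δ) δ) :=
      isSolOn_mono D.sol subset_rfl fun ξ hξ => ⟨hBO hξ.1, hξ.2⟩
    have hγev : ∀ᶠ t in (U : Filter ℝ), σ (u t) = γ :=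
      D.lim.eventually ((isOpen_discrete {γ}).mem_nhds rfl)
    have hcst : ∀ s ∈ Set.Icc (-δ) δ,
        V (φ s, γ) = sInf ((fun t => V (x t, σ t)) '' ({t | σ t = γ} ∩ Set.Ici 0)) := by
      intro s hs
      have htop : Tendsto (fun t => u t + s) U atTop := tendsto_atTop_add_const_right _ _ D.top
      have hσev : ∀ᶠ t in (U : Filter ℝ), σ (u t + s) = γ := by
        filter_upwards [D.cst, hγev] with t ht htγ
        rw [ht.2 s hs, htγ]
      have h1 := tendsto_sInf_of_antitoneOn (hA.nonincr γ) (hbdd γ) htop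
        (hσev.and (htop.eventually_ge_atTop 0))
      have h2 := D.conv (fun _ => s) s hs (Filter.Eventually.of_forall fun _ => hs)
        tendsto_const_nhds
      have h3 : Tendsto (fun t => V (x (u t + s), γ)) U (𝓝 (V (φ s, γ))) :=
        (hcV γ (φ s) (hsol.2.1 s hs)).tendsto.comp h2
      refine tendsto_nhds_unique (h3.congr' ?_) h1
      filter_upwards [hσev] with t ht
      rw [ht]
    have hm : (0:ℝ) ∈ Set.Icc (-δ) δ := ⟨by linarith [D.pos], D.pos.le⟩
    have hmem := mem_sets_of_sol (w := fun ξ => W (ξ, γ)) D.pos hsol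
      (W_zero_of_const hf hA.classV hW hsol hcst)
    simp only [Set.mem_iUnion]
    exact ⟨γ, γ, ⟨hmem, hcst 0 hm⟩, hcst 0 hm⟩

end
end
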